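/- There exists a universal constant C > 0 (independent of N) such that for every N > 0, every choice of sign ±, and every Schwartz function g on ℝ³, the function u(t,x) = ∫_{ℝ³} exp(i x·ξ ± i t N |ξ_h|/|ξ|) ĝ(ξ) dξ satisfies ‖u‖_{L⁶(ℝ_t × ℝ³_x)} ≤ C N^{−1/6} ‖g‖_{Ḣ¹}. -/

import Mathlib

open MeasureTheory Complex
open scoped ENNReal RealInnerProductSpace

noncomputable section

/-- Fourier transform `f̂(ξ) = ∫ e^{-i x·ξ} f(x) dx` on `ℝⁿ`. -/
def fourierTf {n : ℕ} (f : EuclideanSpace ℝ (Fin n) → ℂ) (ξ : EuclideanSpace ℝ (Fin n)) : ℂ :=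
  ∫ x : EuclideanSpace ℝ (Fin n), Complex.exp (-Complex.I * Complex.ofReal ⟪x, ξ⟫) * f x

/-- Homogeneous Sobolev norm `‖f‖_{Ḣˢ}` on `ℝⁿ`. -/
def sobolevNorm {n : ℕ} (s : ℝ) (f : EuclideanSpace ℝ (Fin n) → ℂ) : ℝ :=
  (∫ ξ : EuclideanSpace ℝ (Fin n), ‖ξ‖ ^ (2 * s) * ‖fourierTf f ξ‖ ^ 2) ^ (1 / 2 : ℝ)

/-- The stratification dispersion relation `|ξ_h| / |ξ|`. -/
def pStrat (ξ : EuclideanSpace ℝ (Fin 3)) : ℝ :=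
  Real.sqrt ((ξ 0) ^ 2 + (ξ 1) ^ 2) / ‖ξ‖


lemma aux_gauss1 (e : ℝ) (he : 0 < e) (p : ℝ) :
    ∫ x : ℝ, cexp (I * ↑(x * p)) * ↑(Real.exp (-e * x ^ 2))
      = ↑(Real.sqrt (Real.pi / e) * Real.exp (-p ^ 2 / (4 * e))) := by
  have h := fourierIntegral_gaussian (b := (e : ℂ)) (by simpa using he) (p : ℂ)
  have e1 : ((Real.pi : ℂ) / (e : ℂ)) ^ (1 / 2 : ℂ) = ((Real.sqrt (Real.pi / e) : ℝ) : ℂ) := by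
    rw [Real.sqrt_eq_rpow, Complex.ofReal_cpow (by positivity)]
    push_cast
    rfl
  rw [e1] at h
  rw [Complex.ofReal_mul, Complex.ofReal_exp]
  push_cast
  rw [← h]
  congr 1
  ext x
  congr 2
  ring

lemma aux_gauss2 (e : ℝ) (he : 0 < e) (p q : ℝ) :
    ∫ w : ℝ × ℝ, cexp (I * ↑(w.1 * p + w.2 * q)) * ↑(Real.exp (-e * (w.1 ^ 2 + w.2 ^ 2)))
      = ↑((Real.pi / e) * Real.exp (-(p ^ 2 + q ^ 2) / (4 * e))) := by
  have h := integral_prod_mul (μ := (volume : Measure ℝ)) (ν := (volume : Measure ℝ))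
    (fun x : ℝ => cexp (I * ↑(x * p)) * ↑(Real.exp (-e * x ^ 2)))
    (fun x : ℝ => cexp (I * ↑(x * q)) * ↑(Real.exp (-e * x ^ 2)))
  rw [aux_gauss1 e he, aux_gauss1 e he, ← Measure.volume_eq_prod] at h
  have hs : Real.sqrt (Real.pi / e) * Real.sqrt (Real.pi / e) = Real.pi / e :=
    Real.mul_self_sqrt (by positivity)
  have e2 : ((Real.sqrt (Real.pi / e) * Real.exp (-p ^ 2 / (4 * e)) : ℝ) : ℂ) *
      ((Real.sqrt (Real.pi / e) * Real.exp (-q ^ 2 / (4 * e)) : ℝ) : ℂ)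
      = ↑((Real.pi / e) * Real.exp (-(p ^ 2 + q ^ 2) / (4 * e))) := by
    rw [← Complex.ofReal_mul]
    congr 1
    rw [show -(p ^ 2 + q ^ 2) / (4 * e) = -p ^ 2 / (4 * e) + -q ^ 2 / (4 * e) by ring,
      Real.exp_add]
    linear_combination (Real.exp (-p ^ 2 / (4 * e)) * Real.exp (-q ^ 2 / (4 * e))) * hs
  rw [← e2, ← h]
  congr 1
  ext w
  rw [show I * ((w.1 * p + w.2 * q : ℝ) : ℂ) = I * ((w.1 * p : ℝ) : ℂ) + I * ((w.2 * q : ℝ) : ℂ) by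
    push_cast; ring, Complex.exp_add,
    show -e * (w.1 ^ 2 + w.2 ^ 2) = -e * w.1 ^ 2 + -e * w.2 ^ 2 by ring, Real.exp_add]
  push_cast
  ring

lemma aux_gauss_int (e : ℝ) (he : 0 < e) :
    Integrable (fun w : ℝ × ℝ => Real.exp (-e * (w.1 ^ 2 + w.2 ^ 2))) := by
  have := (integrable_exp_neg_mul_sq he).mul_prod (integrable_exp_neg_mul_sq he)
  rw [← Measure.volume_eq_prod] at this
  refine this.congr (Filter.Eventually.of_forall fun w => ?_)
  simp only
  rw [← Real.exp_add]
  congr 1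
  ring

lemma aux_gauss_lint (e : ℝ) (he : 0 < e) :
    ∫⁻ w : ℝ × ℝ, ENNReal.ofReal ((Real.pi / e) * Real.exp (-(w.1 ^ 2 + w.2 ^ 2) / (4 * e)))
      = ENNReal.ofReal ((2 * Real.pi) ^ 2) := by
  have h4 : 0 < 1 / (4 * e) := by positivity
  have hi := (aux_gauss_int _ h4).const_mul (Real.pi / e)
  have hv := aux_gauss2 _ h4 0 0
  have : ∀ w : ℝ × ℝ, (Real.pi / e) * Real.exp (-(w.1 ^ 2 + w.2 ^ 2) / (4 * e)) =
      (Real.pi / e) * Real.exp (-(1 / (4 * e)) * (w.1 ^ 2 + w.2 ^ 2)) := by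
    intro w; congr 2; ring
  simp_rw [this]
  rw [← ofReal_integral_eq_lintegral_ofReal hi
    (Filter.Eventually.of_forall fun w => by positivity)]
  congr 1
  rw [integral_const_mul]
  simp only [mul_zero, add_zero, ofReal_zero, Complex.exp_zero, one_mul, integral_complex_ofReal] at hv
  have hv' := Complex.ofReal_injective hv
  rw [hv']
  simp
  field_simp
  norm_num

lemma schur_gauss_eps {X : Type*} [MeasurableSpace X] (μ : Measure X) [SFinite μ] (P Q : X → ℝ)
    (hP : Measurable P) (hQ : Measurable Q) (C : ℝ≥0∞)
    (hmap : ∀ G : ℝ × ℝ → ℝ≥0∞, Measurable G → ∫⁻ x, G (P x, Q x) ∂μ ≤ C * ∫⁻ w, G w)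
    (H : X → ℂ) (hHm : Measurable H) (hH : Integrable H μ) (e : ℝ) (he : 0 < e) :
    ∫⁻ w : ℝ × ℝ, ‖∫ x, cexp (I * ↑(w.1 * P x + w.2 * Q x)) * H x ∂μ‖ₑ ^ 2 *
        ENNReal.ofReal (Real.exp (-e * (w.1 ^ 2 + w.2 ^ 2)))
      ≤ ENNReal.ofReal ((2 * Real.pi) ^ 2) * C * ∫⁻ x, ‖H x‖ₑ ^ 2 ∂μ := by
  set U : ℝ × ℝ → ℂ := fun w => ∫ x, cexp (I * ↑(w.1 * P x + w.2 * Q x)) * H x ∂μ with hU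
  set γ : ℝ × ℝ → ℝ := fun w => Real.exp (-e * (w.1 ^ 2 + w.2 ^ 2)) with hγ
  set γh : ℝ → ℝ → ℝ := fun p q => (Real.pi / e) * Real.exp (-(p ^ 2 + q ^ 2) / (4 * e)) with hγh
  have hγhm : Measurable (fun w : ℝ × ℝ => γh w.1 w.2) := by
    rw [hγh]; fun_prop
  have hγh0 : ∀ p q, 0 ≤ γh p q := fun p q => by rw [hγh]; positivity
  -- the triple integrand
  set K : (ℝ × ℝ) × (X × X) → ℂ := fun z =>
    cexp (I * ↑(z.1.1 * (P z.2.1 - P z.2.2) + z.1.2 * (Q z.2.1 - Q z.2.2))) * (γ z.1 : ℂ) *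
      (H z.2.1 * (starRingEnd ℂ) (H z.2.2)) with hK
  have hHc : Integrable (fun x => (starRingEnd ℂ) (H x)) μ := by
    refine hH.congr' ?_ ?_
    · exact (Complex.continuous_conj.measurable.comp hHm).aestronglyMeasurable
    · exact Filter.Eventually.of_forall fun x => by simp
  have hnorm : ∀ r : ℝ, ‖cexp (I * (r : ℂ))‖ = 1 := fun r => by
    rw [mul_comm]; exact Complex.norm_exp_ofReal_mul_I r
  have hKint : Integrable K (volume.prod (μ.prod μ)) := by
    have h1 : Integrable (fun z : (ℝ × ℝ) × (X × X) => (γ z.1 : ℂ) *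
      (H z.2.1 * (starRingEnd ℂ) (H z.2.2))) (volume.prod (μ.prod μ)) :=
      (aux_gauss_int e he).ofReal.mul_prod (hH.mul_prod hHc)
    refine h1.congr' ?_ ?_
    · refine Measurable.aestronglyMeasurable ?_
      have : Measurable (fun z : (ℝ × ℝ) × (X × X) => (starRingEnd ℂ) (H z.2.2)) :=
        Complex.continuous_conj.measurable.comp (by fun_prop)
      rw [hK, hγ]
      fun_prop
    · refine Filter.Eventually.of_forall fun z => ?_
      simp only [hK, norm_mul, hnorm, one_mul]
  have hUsq : ∀ w, ((‖U w‖ ^ 2 * γ w : ℝ) : ℂ) = ∫ v, K (w, v) ∂(μ.prod μ) := by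
    intro w
    have hc : (starRingEnd ℂ) (U w) =
        ∫ x, (starRingEnd ℂ) (cexp (I * ↑(w.1 * P x + w.2 * Q x)) * H x) ∂μ := integral_conj.symm
    have : ((‖U w‖ ^ 2 * γ w : ℝ) : ℂ) = (γ w : ℂ) * (U w * (starRingEnd ℂ) (U w)) := by
      rw [Complex.mul_conj, Complex.normSq_eq_norm_sq]; push_cast; ring
    rw [this, hc, hU]
    simp only
    rw [← integral_prod_mul, ← integral_const_mul]
    congr 1
    ext v
    simp only [hK, map_mul]
    rw [← Complex.exp_conj]
    simp only [map_mul, Complex.conj_I, Complex.conj_ofReal]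
    have : cexp (I * ↑(w.1 * (P v.1 - P v.2) + w.2 * (Q v.1 - Q v.2))) =
      cexp (I * ↑(w.1 * P v.1 + w.2 * Q v.1)) * cexp (-I * ↑(w.1 * P v.2 + w.2 * Q v.2)) := by
      rw [← Complex.exp_add]; congr 1; push_cast; ring
    rw [this]; ring
  have hint : Integrable (fun w => ‖U w‖ ^ 2 * γ w) := by
    have h2 := hKint.integral_prod_left
    simp_rw [← hUsq] at h2
    have h3 := h2.re
    simpa only [RCLike.re_to_complex, Complex.ofReal_re] using h3
  have hkey : ((∫ w, ‖U w‖ ^ 2 * γ w : ℝ) : ℂ) = ∫ v, (γh (P v.1 - P v.2) (Q v.1 - Q v.2) : ℂ) *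
      (H v.1 * (starRingEnd ℂ) (H v.2)) ∂(μ.prod μ) := by
    rw [← integral_complex_ofReal]
    simp_rw [hUsq]
    rw [integral_integral_swap hKint]
    congr 1
    ext v
    simp only [hK]
    rw [integral_mul_const, aux_gauss2 e he]
  have hlhs : ∫⁻ w : ℝ × ℝ, ‖U w‖ₑ ^ 2 * ENNReal.ofReal (γ w)
      = ‖((∫ w, ‖U w‖ ^ 2 * γ w : ℝ) : ℂ)‖ₑ := by
    have hnn : 0 ≤ ∫ w, ‖U w‖ ^ 2 * γ w := integral_nonneg fun w => by
      simp only [hγ, Pi.zero_apply]; positivity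
    have : ‖((∫ w, ‖U w‖ ^ 2 * γ w : ℝ) : ℂ)‖ₑ = ENNReal.ofReal (∫ w, ‖U w‖ ^ 2 * γ w) := by
      rw [← ofReal_norm, Complex.norm_real, Real.norm_of_nonneg hnn]
    rw [this, ofReal_integral_eq_lintegral_ofReal hint (Filter.Eventually.of_forall fun w => by
      simp only [hγ, Pi.zero_apply]; positivity)]
    congr 1
    ext w
    rw [ENNReal.ofReal_mul (by positivity), ENNReal.ofReal_pow (by positivity),
      ofReal_norm]
  rw [hlhs, hkey]
  have hγm2 : Measurable fun v : X × X => ENNReal.ofReal (γh (P v.1 - P v.2) (Q v.1 - Q v.2)) := by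
    rw [hγh]; fun_prop
  set W : X × X → ℝ≥0∞ := fun v => ENNReal.ofReal (γh (P v.1 - P v.2) (Q v.1 - Q v.2)) with hW
  have hWsymm : ∀ x y, W (x, y) = W (y, x) := by
    intro x y; simp only [hW, hγh]; congr 3; ring_nf
  have hWint : ∀ x, ∫⁻ y, W (x, y) ∂μ ≤ C * ENNReal.ofReal ((2 * Real.pi) ^ 2) := by
    intro x
    have h3 := hmap (fun w => ENNReal.ofReal (γh (P x - w.1) (Q x - w.2))) (by
      rw [hγh]; fun_prop)
    refine h3.trans (le_of_eq ?_)
    congr 1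
    rw [← aux_gauss_lint e he]
    have := lintegral_sub_left_eq_self (μ := (volume : Measure (ℝ × ℝ)))
      (fun w : ℝ × ℝ => ENNReal.ofReal (γh w.1 w.2)) (P x, Q x)
    exact this
  calc _ ≤ ∫⁻ v, ‖(γh (P v.1 - P v.2) (Q v.1 - Q v.2) : ℂ) *
      (H v.1 * (starRingEnd ℂ) (H v.2))‖ₑ ∂(μ.prod μ) := enorm_integral_le_lintegral_enorm _
    _ = ∫⁻ v, W v * (‖H v.1‖ₑ * ‖H v.2‖ₑ) ∂(μ.prod μ) := by
      congr 1
      ext v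
      rw [enorm_mul, enorm_mul]
      congr 1
      · rw [← ofReal_norm, Complex.norm_real, Real.norm_of_nonneg (hγh0 _ _)]
      · congr 1
        rw [← ofReal_norm, ← ofReal_norm]; simp
    _ ≤ ∫⁻ v, (2⁻¹ * (W v * ‖H v.1‖ₑ ^ 2) + 2⁻¹ * (W v * ‖H v.2‖ₑ ^ 2)) ∂(μ.prod μ) := by
      refine lintegral_mono fun v => ?_
      rw [← mul_add, ← mul_add, mul_left_comm 2⁻¹ (W v)]
      refine mul_le_mul_right ?_ (W v)
      have := two_mul_le_add_sq (‖H v.1‖₊) (‖H v.2‖₊)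
      have h5 : (2 : ℝ≥0∞) * ‖H v.1‖ₑ * ‖H v.2‖ₑ ≤ ‖H v.1‖ₑ ^ 2 + ‖H v.2‖ₑ ^ 2 := by
        simp only [enorm_eq_nnnorm]; exact_mod_cast this
      calc ‖H v.1‖ₑ * ‖H v.2‖ₑ = 2⁻¹ * (2 * ‖H v.1‖ₑ * ‖H v.2‖ₑ) := by
            rw [mul_assoc, ← mul_assoc 2⁻¹, ENNReal.inv_mul_cancel (by simp) (by simp), one_mul]
        _ ≤ _ := by gcongr
    _ = 2⁻¹ * ∫⁻ v, W v * ‖H v.1‖ₑ ^ 2 ∂(μ.prod μ) + 2⁻¹ * ∫⁻ v, W v * ‖H v.2‖ₑ ^ 2 ∂(μ.prod μ) := by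
      rw [lintegral_add_left (by fun_prop), lintegral_const_mul _ (by fun_prop),
        lintegral_const_mul _ (by fun_prop)]
    _ = ∫⁻ v, W v * ‖H v.1‖ₑ ^ 2 ∂(μ.prod μ) := by
      have : ∫⁻ v, W v * ‖H v.2‖ₑ ^ 2 ∂(μ.prod μ) = ∫⁻ v, W v * ‖H v.1‖ₑ ^ 2 ∂(μ.prod μ) := by
        rw [← lintegral_prod_swap]
        congr 1
        ext v
        rcases v with ⟨x, y⟩
        simp only [Prod.swap_prod_mk]
        rw [hWsymm]
      rw [this, ← add_mul, ENNReal.inv_two_add_inv_two, one_mul]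
    _ = ∫⁻ x, ∫⁻ y, W (x, y) * ‖H x‖ₑ ^ 2 ∂μ ∂μ := by
      rw [lintegral_prod _ (by fun_prop)]
    _ ≤ ∫⁻ x, (C * ENNReal.ofReal ((2 * Real.pi) ^ 2)) * ‖H x‖ₑ ^ 2 ∂μ := by
      refine lintegral_mono fun x => ?_
      rw [lintegral_mul_const _ (by fun_prop)]
      gcongr
      exact hWint x
    _ = _ := by
      rw [lintegral_const_mul _ (by fun_prop), mul_comm C]

lemma schur_gauss {X : Type*} [MeasurableSpace X] (μ : Measure X) [SFinite μ] (P Q : X → ℝ)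
    (hP : Measurable P) (hQ : Measurable Q) (C : ℝ≥0∞)
    (hmap : ∀ G : ℝ × ℝ → ℝ≥0∞, Measurable G → ∫⁻ x, G (P x, Q x) ∂μ ≤ C * ∫⁻ w, G w)
    (H : X → ℂ) (hHm : Measurable H) (hH : Integrable H μ) :
    ∫⁻ w : ℝ × ℝ, ‖∫ x, cexp (I * ↑(w.1 * P x + w.2 * Q x)) * H x ∂μ‖ₑ ^ 2
      ≤ ENNReal.ofReal ((2 * Real.pi) ^ 2) * C * ∫⁻ x, ‖H x‖ₑ ^ 2 ∂μ := by
  have hUm : Measurable fun w : ℝ × ℝ => ‖∫ x, cexp (I * ↑(w.1 * P x + w.2 * Q x)) * H x ∂μ‖ₑ := by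
    refine (StronglyMeasurable.measurable ?_).enorm
    exact StronglyMeasurable.integral_prod_right'
      (f := fun z : (ℝ × ℝ) × X => cexp (I * ↑(z.1.1 * P z.2 + z.1.2 * Q z.2)) * H z.2)
      (Measurable.stronglyMeasurable (by fun_prop))
  have hlim : ∀ w : ℝ × ℝ, Filter.Tendsto (fun n : ℕ =>
      ‖∫ x, cexp (I * ↑(w.1 * P x + w.2 * Q x)) * H x ∂μ‖ₑ ^ 2 *
        ENNReal.ofReal (Real.exp (-(1 / ((n : ℝ) + 1)) * (w.1 ^ 2 + w.2 ^ 2)))) Filter.atTop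
      (nhds (‖∫ x, cexp (I * ↑(w.1 * P x + w.2 * Q x)) * H x ∂μ‖ₑ ^ 2)) := by
    intro w
    have h1 : Filter.Tendsto (fun n : ℕ => ENNReal.ofReal
        (Real.exp (-(1 / ((n : ℝ) + 1)) * (w.1 ^ 2 + w.2 ^ 2)))) Filter.atTop (nhds 1) := by
      rw [← ENNReal.ofReal_one]
      refine ENNReal.tendsto_ofReal ?_
      have := ((tendsto_one_div_add_atTop_nhds_zero_nat (𝕜 := ℝ)).neg.mul_const
        (w.1 ^ 2 + w.2 ^ 2)).rexp
      simpa using this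
    have := ENNReal.Tendsto.const_mul (a := ‖∫ x, cexp (I * ↑(w.1 * P x + w.2 * Q x)) * H x ∂μ‖ₑ ^ 2)
      h1 (Or.inl one_ne_zero)
    simpa using this
  calc _ = ∫⁻ w : ℝ × ℝ, Filter.liminf (fun n : ℕ =>
      ‖∫ x, cexp (I * ↑(w.1 * P x + w.2 * Q x)) * H x ∂μ‖ₑ ^ 2 *
        ENNReal.ofReal (Real.exp (-(1 / ((n : ℝ) + 1)) * (w.1 ^ 2 + w.2 ^ 2)))) Filter.atTop := by
        congr 1; ext w; exact (hlim w).liminf_eq.symm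
    _ ≤ Filter.liminf (fun n : ℕ => ∫⁻ w : ℝ × ℝ,
      ‖∫ x, cexp (I * ↑(w.1 * P x + w.2 * Q x)) * H x ∂μ‖ₑ ^ 2 *
        ENNReal.ofReal (Real.exp (-(1 / ((n : ℝ) + 1)) * (w.1 ^ 2 + w.2 ^ 2)))) Filter.atTop :=
        lintegral_liminf_le (fun n => by fun_prop)
    _ ≤ _ := by
      refine Filter.liminf_le_of_frequently_le' (Filter.Frequently.of_forall fun n => ?_)
      exact schur_gauss_eps μ P Q hP hQ C hmap H hHm hH _ (by positivity)


lemma ray_bound (S : Set ℝ) (hS : S.OrdConnected) (ψ D : ℝ → ℝ)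
    (hD : ∀ y ∈ S, HasDerivAt ψ (D y) y) (lam : ℝ) (hlam : 0 < lam) (σ : ℝ)
    (hσ : σ = 1 ∨ σ = -1)
    (hmono : ∀ y ∈ S, ∀ y' ∈ S, y ≤ y' → lam * (y' - y) ≤ σ * (D y' - D y))
    (c e1 e2 e3 : ℝ) (hsum : e1 + e2 + e3 = 0) (hsq : e1 ^ 2 + e2 ^ 2 = 1) (G : ℝ → ℝ≥0∞) :
    ∫⁻ r in {r : ℝ | 0 < r ∧ c + r * e1 ∈ S ∧ c + r * e2 ∈ S ∧ c + r * e3 ∈ S},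
      ENNReal.ofReal r * G (ψ (c + r * e1) + ψ (c + r * e2) + ψ (c + r * e3))
      ≤ ENNReal.ofReal (1 / lam) * ∫⁻ τ, G τ := by
  set J := {r : ℝ | 0 < r ∧ c + r * e1 ∈ S ∧ c + r * e2 ∈ S ∧ c + r * e3 ∈ S} with hJ
  set Ψ : ℝ → ℝ := fun r => ψ (c + r * e1) + ψ (c + r * e2) + ψ (c + r * e3) with hΨ
  set Ψ' : ℝ → ℝ := fun r => D (c + r * e1) * e1 + D (c + r * e2) * e2 + D (c + r * e3) * e3
    with hΨ'
  have hconv : ∀ e : ℝ, Convex ℝ {r : ℝ | c + r * e ∈ S} := by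
    intro e
    have : {r : ℝ | c + r * e ∈ S} = (AffineMap.lineMap c (c + e) : ℝ →ᵃ[ℝ] ℝ) ⁻¹' S := by
      ext r
      simp only [Set.mem_ofPred_eq, Set.mem_preimage, AffineMap.lineMap_apply_module']
      rw [show r • (c + e - c) + c = c + r * e by simp [smul_eq_mul]; ring]
    rw [this]
    exact (hS.convex).affine_preimage _
  have hJc : Convex ℝ J := by
    have : J = Set.Ioi 0 ∩ ({r : ℝ | c + r * e1 ∈ S} ∩ ({r : ℝ | c + r * e2 ∈ S} ∩
      {r : ℝ | c + r * e3 ∈ S})) := by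
      ext r; simp [hJ]
    rw [this]
    exact (convex_Ioi 0).inter ((hconv _).inter ((hconv _).inter (hconv _)))
  have hJm : MeasurableSet J := hJc.ordConnected.measurableSet
  have hder : ∀ r ∈ J, HasDerivAt Ψ (Ψ' r) r := by
    intro r hr
    have hl : ∀ e : ℝ, HasDerivAt (fun r : ℝ => c + r * e) e r := fun e => by
      simpa using ((hasDerivAt_id r).mul_const e).const_add c
    exact (((hD _ hr.2.1).comp r (hl e1)).add ((hD _ hr.2.2.1).comp r (hl e2))).add
      ((hD _ hr.2.2.2).comp r (hl e3))
  have hcS : ∀ r ∈ J, c ∈ S := by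
    intro r hr
    obtain ⟨h0, h1, h2, h3⟩ := hr
    have key : ∀ a b : ℝ, a ≤ 0 → 0 ≤ b → c + r * a ∈ S → c + r * b ∈ S → c ∈ S := by
      intro a b ha hb hA hB
      refine hS.out hA hB ⟨?_, ?_⟩ <;> nlinarith
    rcases le_total e1 0 with a1 | a1 <;> rcases le_total e2 0 with a2 | a2
    · exact key e1 e3 a1 (by linarith) h1 h3
    · exact key e1 e2 a1 a2 h1 h2
    · exact key e2 e1 a2 a1 h2 h1
    · exact key e3 e1 (by linarith) a1 h3 h1
  have hlow : ∀ r ∈ J, lam * r ≤ σ * Ψ' r := by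
    intro r hr
    have hc := hcS r hr
    obtain ⟨h0, h1, h2, h3⟩ := hr
    have key : ∀ e : ℝ, c + r * e ∈ S → lam * r * e ^ 2 ≤ σ * (D (c + r * e) - D c) * e := by
      intro e he
      rcases le_total e 0 with a | a
      · have := hmono _ he _ hc (by nlinarith)
        nlinarith
      · have := hmono _ hc _ he (by nlinarith)
        nlinarith
    have k1 := key e1 h1
    have k2 := key e2 h2
    have k3 := key e3 h3
    have e3eq : e3 = -e1 - e2 := by linarith
    have : σ * Ψ' r = σ * (D (c + r * e1) - D c) * e1 + σ * (D (c + r * e2) - D c) * e2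
        + σ * (D (c + r * e3) - D c) * e3 := by
      simp only [hΨ']; linear_combination (σ * D c) * hsum
    rw [this]
    have hp : 0 ≤ lam * r * e3 ^ 2 := by positivity
    have : lam * r = lam * r * e1 ^ 2 + lam * r * e2 ^ 2 := by rw [← mul_add, hsq, mul_one]
    linarith
  have hcont : ContinuousOn Ψ J := fun r hr => (hder r hr).continuousAt.continuousWithinAt
  have hinj : Set.InjOn Ψ J := by
    rcases hσ with h | h
    · refine (strictMonoOn_of_hasDerivWithinAt_pos hJc hcont (f' := Ψ') (fun x hx =>
        (hder x (interior_subset hx)).hasDerivWithinAt) (fun x hx => ?_)).injOn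
      have := hlow x (interior_subset hx)
      have h0 := (interior_subset hx).1
      rw [h] at this
      nlinarith
    · refine (strictAntiOn_of_hasDerivWithinAt_neg hJc hcont (f' := Ψ') (fun x hx =>
        (hder x (interior_subset hx)).hasDerivWithinAt) (fun x hx => ?_)).injOn
      have := hlow x (interior_subset hx)
      have h0 := (interior_subset hx).1
      rw [h] at this
      nlinarith
  have hcv := lintegral_image_eq_lintegral_abs_deriv_mul hJm
    (fun x hx => (hder x hx).hasDerivWithinAt) hinj G
  calc ∫⁻ r in J, ENNReal.ofReal r * G (Ψ r)
      ≤ ∫⁻ r in J, ENNReal.ofReal (1 / lam) * (ENNReal.ofReal |Ψ' r| * G (Ψ r)) := by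
        refine setLIntegral_mono' hJm fun r hr => ?_
        rw [← mul_assoc, ← ENNReal.ofReal_mul (by positivity)]
        gcongr
        have h1 := hlow r hr
        have h2 : σ * Ψ' r ≤ |Ψ' r| := by
          rcases hσ with h | h <;> rw [h]
          · simpa using le_abs_self _
          · simpa using neg_le_abs _
        rw [one_div, ← div_eq_inv_mul, le_div_iff₀ hlam]
        linarith
    _ = ENNReal.ofReal (1 / lam) * ∫⁻ r in J, (ENNReal.ofReal |Ψ' r| * G (Ψ r)) :=
        lintegral_const_mul' _ _ ENNReal.ofReal_ne_top
    _ = ENNReal.ofReal (1 / lam) * ∫⁻ τ in Set.image Ψ J, G τ := by rw [hcv]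
    _ ≤ _ := by gcongr; exact Measure.restrict_le_self

lemma plane_bound (S : Set ℝ) (hS : S.OrdConnected) (ψ D : ℝ → ℝ) (hψ : Measurable ψ)
    (hD : ∀ y ∈ S, HasDerivAt ψ (D y) y) (lam : ℝ) (hlam : 0 < lam) (σ : ℝ)
    (hσ : σ = 1 ∨ σ = -1)
    (hmono : ∀ y ∈ S, ∀ y' ∈ S, y ≤ y' → lam * (y' - y) ≤ σ * (D y' - D y))
    (c : ℝ) (G : ℝ → ℝ≥0∞) (hG : Measurable G) :
    ∫⁻ p : ℝ × ℝ, {p : ℝ × ℝ | c + p.1 ∈ S ∧ c + p.2 ∈ S ∧ c + (-p.1 - p.2) ∈ S}.indicator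
      (fun p => G (ψ (c + p.1) + ψ (c + p.2) + ψ (c + (-p.1 - p.2)))) p
      ≤ ENNReal.ofReal (2 * Real.pi / lam) * ∫⁻ τ, G τ := by
  classical
  have hSm := hS.measurableSet
  set A := {p : ℝ × ℝ | c + p.1 ∈ S ∧ c + p.2 ∈ S ∧ c + (-p.1 - p.2) ∈ S} with hA
  have hAm : MeasurableSet A := by
    have m1 : Measurable fun p : ℝ × ℝ => c + p.1 := by fun_prop
    have m2 : Measurable fun p : ℝ × ℝ => c + p.2 := by fun_prop
    have m3 : Measurable fun p : ℝ × ℝ => c + (-p.1 - p.2) := by fun_prop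
    exact (m1 hSm).inter ((m2 hSm).inter (m3 hSm))
  set F : ℝ × ℝ → ℝ≥0∞ := A.indicator
      (fun p => G (ψ (c + p.1) + ψ (c + p.2) + ψ (c + (-p.1 - p.2)))) with hF
  have hFm : Measurable F := by
    refine Measurable.indicator ?_ hAm
    fun_prop
  have hsm : Measurable fun p : ℝ × ℝ => (p.1 * Real.cos p.2, p.1 * Real.sin p.2) := by fun_prop
  rw [← lintegral_comp_polarCoord_symm]
  simp only [polarCoord_target, polarCoord_symm_apply, smul_eq_mul]
  rw [Measure.volume_eq_prod, ← Measure.prod_restrict]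
  have hFm2 : Measurable fun p : ℝ × ℝ => F (p.1 * Real.cos p.2, p.1 * Real.sin p.2) :=
    hFm.comp hsm
  rw [lintegral_prod_symm _ (by fun_prop)]
  calc _ ≤ ∫⁻ θ in Set.Ioo (-Real.pi) Real.pi, ENNReal.ofReal (1 / lam) * ∫⁻ τ, G τ := by
        refine lintegral_mono fun θ => ?_
        have hb := ray_bound S hS ψ D hD lam hlam σ hσ hmono c (Real.cos θ) (Real.sin θ)
          (-Real.cos θ - Real.sin θ) (by ring) (Real.cos_sq_add_sin_sq θ) G
        refine le_trans (le_of_eq ?_) hb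
        have hJm : MeasurableSet {r : ℝ | 0 < r ∧ c + r * Real.cos θ ∈ S ∧ c + r * Real.sin θ ∈ S ∧
            c + r * (-Real.cos θ - Real.sin θ) ∈ S} := by
          have m1 : Measurable fun r : ℝ => c + r * Real.cos θ := by fun_prop
          have m2 : Measurable fun r : ℝ => c + r * Real.sin θ := by fun_prop
          have m3 : Measurable fun r : ℝ => c + r * (-Real.cos θ - Real.sin θ) := by fun_prop
          exact measurableSet_Ioi.inter ((m1 hSm).inter ((m2 hSm).inter (m3 hSm)))
        rw [← lintegral_indicator measurableSet_Ioi, ← lintegral_indicator hJm]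
        congr 1
        ext r
        simp only [Set.indicator_apply, Set.mem_Ioi, hF, hA, Set.mem_ofPred_eq]
        have : -(r * Real.cos θ) - r * Real.sin θ = r * (-Real.cos θ - Real.sin θ) := by ring
        rw [this]
        by_cases h0 : 0 < r <;> simp [h0]
    _ = _ := by
        rw [lintegral_const]
        simp only [MeasurableSet.univ, Measure.restrict_apply, Set.univ_inter, Real.volume_Ioo]
        rw [mul_right_comm, ← ENNReal.ofReal_mul (by positivity)]
        congr 2
        ring

lemma cube_bound (S : Set ℝ) (hS : S.OrdConnected) (ψ D : ℝ → ℝ) (hψ : Measurable ψ)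
    (hD : ∀ y ∈ S, HasDerivAt ψ (D y) y) (lam : ℝ) (hlam : 0 < lam) (σ : ℝ)
    (hσ : σ = 1 ∨ σ = -1)
    (hmono : ∀ y ∈ S, ∀ y' ∈ S, y ≤ y' → lam * (y' - y) ≤ σ * (D y' - D y))
    (G : ℝ × ℝ → ℝ≥0∞) (hG : Measurable G) :
    ∫⁻ x : ℝ × (ℝ × ℝ), G (x.1 + x.2.1 + x.2.2, ψ x.1 + ψ x.2.1 + ψ x.2.2)
      ∂((volume.restrict S).prod ((volume.restrict S).prod (volume.restrict S)))
      ≤ ENNReal.ofReal (2 * Real.pi / lam) * ∫⁻ w, G w := by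
  classical
  have hSm := hS.measurableSet
  set F : ℝ → ℝ → ℝ → ℝ≥0∞ := fun a b c => if (a ∈ S ∧ b ∈ S ∧ c ∈ S) then
    G (a + b + c, ψ a + ψ b + ψ c) else 0 with hF
  have hset : MeasurableSet {x : ℝ × ℝ × ℝ | x.1 ∈ S ∧ x.2.1 ∈ S ∧ x.2.2 ∈ S} :=
    (measurable_fst hSm).inter (((measurable_fst.comp measurable_snd) hSm).inter
      ((measurable_snd.comp measurable_snd) hSm))
  have hFm : Measurable fun x : ℝ × ℝ × ℝ => F x.1 x.2.1 x.2.2 := by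
    simp only [hF]
    exact Measurable.ite hset (by fun_prop) measurable_const
  have hF3 : ∀ {α : Type} [MeasurableSpace α] (f g h : α → ℝ), Measurable f → Measurable g →
      Measurable h → Measurable fun x => F (f x) (g x) (h x) := by
    intro α _ f g h hf hg hh
    exact hFm.comp (hf.prodMk (hg.prodMk hh))
  have h1 : ∫⁻ x : ℝ × (ℝ × ℝ), G (x.1 + x.2.1 + x.2.2, ψ x.1 + ψ x.2.1 + ψ x.2.2)
      ∂((volume.restrict S).prod ((volume.restrict S).prod (volume.restrict S)))
      = ∫⁻ x : ℝ × (ℝ × ℝ), F x.1 x.2.1 x.2.2 := by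
    rw [Measure.prod_restrict, Measure.prod_restrict, ← Measure.volume_eq_prod,
      ← Measure.volume_eq_prod, ← lintegral_indicator (hSm.prod (hSm.prod hSm))]
    congr 1
    ext x
    simp [Set.indicator_apply, hF]
  rw [h1, Measure.volume_eq_prod, lintegral_prod_symm _ hFm.aemeasurable]
  calc _ = ∫⁻ v : ℝ × ℝ, ∫⁻ s, F (s - (v.1 + v.2)) v.1 v.2 := by
        congr 1
        ext v
        exact (lintegral_sub_right_eq_self (fun s => F s v.1 v.2) (v.1 + v.2)).symm
    _ = ∫⁻ s, ∫⁻ v : ℝ × ℝ, F (s - (v.1 + v.2)) v.1 v.2 := by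
        rw [lintegral_lintegral_swap]
        exact (hF3 (fun z : (ℝ × ℝ) × ℝ => z.2 - (z.1.1 + z.1.2)) (fun z => z.1.1) (fun z => z.1.2)
          (by fun_prop) (by fun_prop) (by fun_prop)).aemeasurable
    _ = ∫⁻ s, ∫⁻ v : ℝ × ℝ, F (s / 3 + (-v.1 - v.2)) (s / 3 + v.1) (s / 3 + v.2) := by
        congr 1
        ext s
        rw [← lintegral_add_left_eq_self (μ := (volume : Measure (ℝ × ℝ)))
          (fun v : ℝ × ℝ => F (s - (v.1 + v.2)) v.1 v.2) (s / 3, s / 3)]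
        congr 1
        ext v
        simp only [Prod.fst_add, Prod.snd_add]
        congr 1
        ring
    _ ≤ ∫⁻ s, ENNReal.ofReal (2 * Real.pi / lam) * ∫⁻ τ, G (s, τ) := by
        refine lintegral_mono fun s => ?_
        refine le_trans (le_of_eq ?_) (plane_bound S hS ψ D hψ hD lam hlam σ hσ hmono (s / 3)
          (fun τ => G (s, τ)) (by fun_prop))
        congr 1
        ext v
        simp only [hF, Set.indicator_apply, Set.mem_ofPred_eq]
        have e1 : s / 3 + (-v.1 - v.2) + (s / 3 + v.1) + (s / 3 + v.2) = s := by ring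
        rw [e1]
        have e2 : ψ (s / 3 + (-v.1 - v.2)) + ψ (s / 3 + v.1) + ψ (s / 3 + v.2) =
          ψ (s / 3 + v.1) + ψ (s / 3 + v.2) + ψ (s / 3 + (-v.1 - v.2)) := by ring
        rw [e2]
        congr 1
        apply propext
        tauto
    _ = _ := by
        rw [lintegral_const_mul _ (by fun_prop), Measure.volume_eq_prod, lintegral_prod _ hG.aemeasurable]

lemma strichartz_1d (S : Set ℝ) (hS : S.OrdConnected) (ψ D : ℝ → ℝ) (hψ : Measurable ψ)
    (hD : ∀ y ∈ S, HasDerivAt ψ (D y) y) (lam : ℝ) (hlam : 0 < lam) (σ : ℝ)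
    (hσ : σ = 1 ∨ σ = -1)
    (hmono : ∀ y ∈ S, ∀ y' ∈ S, y ≤ y' → lam * (y' - y) ≤ σ * (D y' - D y))
    (h : ℝ → ℂ) (hm : Measurable h) (hi : Integrable h) (hsupp : ∀ y, y ∉ S → h y = 0) :
    ∫⁻ w : ℝ × ℝ, ‖∫ y, cexp (I * ↑(w.1 * y + w.2 * ψ y)) * h y‖ₑ ^ 6
      ≤ ENNReal.ofReal ((2 * Real.pi) ^ 3 / lam) * (∫⁻ y, ‖h y‖ₑ ^ 2) ^ 3 := by
  set ν : Measure ℝ := volume.restrict S with hν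
  have hiν : Integrable h ν := hi.restrict
  have key := schur_gauss (ν.prod (ν.prod ν)) (fun x => x.1 + x.2.1 + x.2.2)
    (fun x => ψ x.1 + ψ x.2.1 + ψ x.2.2) (by fun_prop) (by fun_prop)
    (ENNReal.ofReal (2 * Real.pi / lam))
    (fun G hG => cube_bound S hS ψ D hψ hD lam hlam σ hσ hmono G hG)
    (fun x => h x.1 * (h x.2.1 * h x.2.2)) (by fun_prop) (hiν.mul_prod (hiν.mul_prod hiν))
  have hl : ∀ w : ℝ × ℝ, ‖∫ y, cexp (I * ↑(w.1 * y + w.2 * ψ y)) * h y‖ₑ ^ 6 =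
      ‖∫ x, cexp (I * ↑(w.1 * (x.1 + x.2.1 + x.2.2) + w.2 * (ψ x.1 + ψ x.2.1 + ψ x.2.2))) *
        (h x.1 * (h x.2.1 * h x.2.2)) ∂(ν.prod (ν.prod ν))‖ₑ ^ 2 := by
    intro w
    set k : ℝ → ℂ := fun y => cexp (I * ↑(w.1 * y + w.2 * ψ y)) * h y with hk
    have e1 : ∫ y, k y = ∫ y, k y ∂ν := by
      rw [hν, setIntegral_eq_integral_of_forall_compl_eq_zero]
      intro y hy
      simp [hk, hsupp y hy]
    have e2 : ∫ x, cexp (I * ↑(w.1 * (x.1 + x.2.1 + x.2.2) + w.2 * (ψ x.1 + ψ x.2.1 + ψ x.2.2))) *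
        (h x.1 * (h x.2.1 * h x.2.2)) ∂(ν.prod (ν.prod ν)) = (∫ y, k y ∂ν) ^ 3 := by
      rw [show (∫ y, k y ∂ν) ^ 3 = (∫ y, k y ∂ν) * ((∫ y, k y ∂ν) * (∫ y, k y ∂ν)) by ring,
        ← integral_prod_mul, ← integral_prod_mul]
      congr 1
      ext x
      simp only [hk]
      have : cexp (I * ↑(w.1 * (x.1 + x.2.1 + x.2.2) + w.2 * (ψ x.1 + ψ x.2.1 + ψ x.2.2))) =
        cexp (I * ↑(w.1 * x.1 + w.2 * ψ x.1)) * (cexp (I * ↑(w.1 * x.2.1 + w.2 * ψ x.2.1)) *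
          cexp (I * ↑(w.1 * x.2.2 + w.2 * ψ x.2.2))) := by
        rw [← Complex.exp_add, ← Complex.exp_add]; congr 1; push_cast; ring
      rw [this]; ring
    rw [e1, e2, enorm_pow, ← pow_mul]
  have hr : ∫⁻ x, ‖h x.1 * (h x.2.1 * h x.2.2)‖ₑ ^ 2 ∂(ν.prod (ν.prod ν))
      ≤ (∫⁻ y, ‖h y‖ₑ ^ 2) ^ 3 := by
    have : ∫⁻ x, ‖h x.1 * (h x.2.1 * h x.2.2)‖ₑ ^ 2 ∂(ν.prod (ν.prod ν)) =
        (∫⁻ y, ‖h y‖ₑ ^ 2 ∂ν) ^ 3 := by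
      rw [show (∫⁻ y, ‖h y‖ₑ ^ 2 ∂ν) ^ 3 = (∫⁻ y, ‖h y‖ₑ ^ 2 ∂ν) *
        ((∫⁻ y, ‖h y‖ₑ ^ 2 ∂ν) * (∫⁻ y, ‖h y‖ₑ ^ 2 ∂ν)) by ring,
        ← lintegral_prod_mul (by fun_prop) (by fun_prop),
        ← lintegral_prod_mul (by fun_prop) (by fun_prop)]
      congr 1
      ext x
      rw [enorm_mul, enorm_mul]; ring
    rw [this]
    gcongr
    exact Measure.restrict_le_self
  simp_rw [hl]
  refine key.trans ?_
  rw [← ENNReal.ofReal_mul (by positivity)]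
  calc _ ≤ ENNReal.ofReal ((2 * Real.pi) ^ 2 * (2 * Real.pi / lam)) * (∫⁻ y, ‖h y‖ₑ ^ 2) ^ 3 := by
        gcongr
    _ = _ := by congr 2; ring

lemma minkowski3 {X Y : Type*} [MeasurableSpace X] [MeasurableSpace Y] (μ : Measure X)
    (ν : Measure Y) [SFinite μ] [SFinite ν] (A : X → Y → ℝ≥0∞)
    (hA : Measurable fun z : X × Y => A z.1 z.2) :
    ∫⁻ w, (∫⁻ x, A x w ∂μ) ^ 3 ∂ν ≤ (∫⁻ x, (∫⁻ w, A x w ^ 3 ∂ν) ^ (1 / 3 : ℝ) ∂μ) ^ 3 := by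
  have hAx : ∀ x, Measurable (A x) := fun x => hA.comp measurable_prodMk_left
  have hAw : ∀ w, Measurable (fun x => A x w) := fun w => hA.comp measurable_prodMk_right
  have hcub : ∀ f : X → ℝ≥0∞, Measurable f → (∫⁻ x, f x ∂μ) ^ 3 =
      ∫⁻ x : X × (X × X), f x.1 * (f x.2.1 * f x.2.2) ∂(μ.prod (μ.prod μ)) := by
    intro f hf
    rw [show (∫⁻ x, f x ∂μ) ^ 3 = (∫⁻ x, f x ∂μ) * ((∫⁻ x, f x ∂μ) * (∫⁻ x, f x ∂μ)) by ring,
      ← lintegral_prod_mul (μ := μ) (ν := μ) (by fun_prop) (by fun_prop),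
      ← lintegral_prod_mul (by fun_prop) (by fun_prop)]
  have hBm : Measurable fun x => (∫⁻ w, A x w ^ 3 ∂ν) ^ (1 / 3 : ℝ) := by
    refine Measurable.pow_const ?_ _
    exact Measurable.lintegral_prod_right' (f := fun z : X × Y => A z.1 z.2 ^ 3) (by fun_prop)
  rw [hcub _ hBm]
  calc _ = ∫⁻ w, ∫⁻ x : X × (X × X), A x.1 w * (A x.2.1 w * A x.2.2 w) ∂(μ.prod (μ.prod μ)) ∂ν := by
        congr 1; ext w; exact hcub _ (hAw w)
    _ = ∫⁻ x : X × (X × X), ∫⁻ w, A x.1 w * (A x.2.1 w * A x.2.2 w) ∂ν ∂(μ.prod (μ.prod μ)) := by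
        rw [lintegral_lintegral_swap]
        refine Measurable.aemeasurable ?_
        have m1 : Measurable fun z : Y × (X × (X × X)) => A z.2.1 z.1 :=
          hA.comp (g := fun z : X × Y => A z.1 z.2)
            (f := fun z : Y × (X × (X × X)) => (z.2.1, z.1)) (by fun_prop)
        have m2 : Measurable fun z : Y × (X × (X × X)) => A z.2.2.1 z.1 :=
          hA.comp (g := fun z : X × Y => A z.1 z.2)
            (f := fun z : Y × (X × (X × X)) => (z.2.2.1, z.1)) (by fun_prop)
        have m3 : Measurable fun z : Y × (X × (X × X)) => A z.2.2.2 z.1 :=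
          hA.comp (g := fun z : X × Y => A z.1 z.2)
            (f := fun z : Y × (X × (X × X)) => (z.2.2.2, z.1)) (by fun_prop)
        exact m1.mul (m2.mul m3)
    _ ≤ _ := by
        refine lintegral_mono fun x => ?_
        have := ENNReal.lintegral_prod_norm_pow_le (μ := ν) (Finset.univ : Finset (Fin 3))
          (f := fun i w => (![A x.1 w, A x.2.1 w, A x.2.2 w] i) ^ 3) (by
            intro i _
            fin_cases i
            · exact ((hAx x.1).pow_const 3).aemeasurable
            · exact ((hAx x.2.1).pow_const 3).aemeasurable
            · exact ((hAx x.2.2).pow_const 3).aemeasurable)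
          (p := fun _ => (1 / 3 : ℝ)) (by norm_num) (by intro i _; norm_num)
        have hp : ∀ a : ℝ≥0∞, (a ^ 3) ^ (1 / 3 : ℝ) = a := by
          intro a
          rw [← ENNReal.rpow_natCast, ← ENNReal.rpow_mul]; norm_num
        simp only [hp, Fin.prod_univ_three, Matrix.cons_val_zero, Matrix.cons_val_one,
          Matrix.cons_val] at this
        simpa only [mul_assoc] using this

/-- The weight `|η|^{1/3}` on the plane. -/
def nw (η : ℝ × ℝ) : ℝ := (η.1 ^ 2 + η.2 ^ 2) ^ (1 / 6 : ℝ)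

lemma nw_nonneg (η : ℝ × ℝ) : 0 ≤ nw η := by unfold nw; positivity

lemma nw_meas : Measurable nw := by unfold nw; fun_prop

lemma nw_pos (η : ℝ × ℝ) (h : η ≠ 0) : 0 < nw η := by
  unfold nw
  refine Real.rpow_pos_of_pos ?_ _
  rcases eq_or_ne η.1 0 with h1 | h1
  · have : η.2 ≠ 0 := fun h2 => h (Prod.ext h1 h2)
    positivity
  · positivity

lemma nw_pow6 (η : ℝ × ℝ) : nw η ^ 6 = η.1 ^ 2 + η.2 ^ 2 := by
  unfold nw
  rw [← Real.rpow_natCast, ← Real.rpow_mul (by positivity)]; norm_num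

lemma nw_polar (r θ : ℝ) (hr : 0 < r) :
    nw (r * Real.cos θ, r * Real.sin θ) = r ^ (1 / 3 : ℝ) := by
  unfold nw
  have : (r * Real.cos θ) ^ 2 + (r * Real.sin θ) ^ 2 = r ^ (2 : ℝ) := by
    rw [Real.rpow_two]; linear_combination r ^ 2 * Real.cos_sq_add_sin_sq θ
  simp only [this]
  rw [← Real.rpow_mul hr.le]; norm_num

lemma rpow_lint (R : ℝ) (hR : 0 < R) :
    ∫⁻ r in Set.Ioc 0 R, ENNReal.ofReal (r ^ (-(1 / 3) : ℝ)) = ENNReal.ofReal (3 / 2 * R ^ (2 / 3 : ℝ)) := by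
  have hi : IntervalIntegrable (fun r : ℝ => r ^ (-(1 / 3) : ℝ)) volume 0 R :=
    intervalIntegral.intervalIntegrable_rpow' (by norm_num)
  rw [← ofReal_integral_eq_lintegral_ofReal ((intervalIntegrable_iff_integrableOn_Ioc_of_le hR.le).1 hi)]
  · rw [← intervalIntegral.integral_of_le hR.le, integral_rpow (Or.inl (by norm_num))]
    congr 1
    rw [Real.zero_rpow (by norm_num)]
    norm_num
    ring
  · refine (ae_restrict_iff' measurableSet_Ioc).2 (Filter.Eventually.of_forall fun r hr => ?_)
    exact Real.rpow_nonneg hr.1.le _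

lemma cube_lint (R : ℝ) (hR : 0 ≤ R) :
    ∫⁻ r in Set.Ioc 0 R, ENNReal.ofReal (r ^ 3) = ENNReal.ofReal (R ^ 4 / 4) := by
  have hi : IntervalIntegrable (fun r : ℝ => r ^ 3) volume 0 R :=
    (continuous_pow 3).intervalIntegrable _ _
  rw [← ofReal_integral_eq_lintegral_ofReal ((intervalIntegrable_iff_integrableOn_Ioc_of_le hR).1 hi)]
  · rw [← intervalIntegral.integral_of_le hR, integral_pow]
    congr 1
    norm_num
  · refine (ae_restrict_iff' measurableSet_Ioc).2 (Filter.Eventually.of_forall fun r hr => ?_)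
    exact pow_nonneg hr.1.le _

lemma low_int (B : ℝ) (hB : 0 < B) :
    ∫⁻ η : ℝ × ℝ, {η : ℝ × ℝ | nw η < B}.indicator (fun η => ENNReal.ofReal ((nw η ^ 4)⁻¹)) η
      ≤ ENNReal.ofReal (3 * Real.pi * B ^ 2) := by
  classical
  have hm : Measurable ({η : ℝ × ℝ | nw η < B}.indicator
      (fun η => ENNReal.ofReal ((nw η ^ 4)⁻¹))) := by
    have := nw_meas
    refine Measurable.indicator (by fun_prop) (measurableSet_lt this measurable_const)
  set F := {η : ℝ × ℝ | nw η < B}.indicator (fun η => ENNReal.ofReal ((nw η ^ 4)⁻¹)) with hF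
  have hsm : Measurable fun p : ℝ × ℝ => (p.1 * Real.cos p.2, p.1 * Real.sin p.2) := by fun_prop
  rw [← lintegral_comp_polarCoord_symm]
  simp only [polarCoord_target, polarCoord_symm_apply, smul_eq_mul]
  rw [Measure.volume_eq_prod, ← Measure.prod_restrict]
  have hFm2 : Measurable fun p : ℝ × ℝ => F (p.1 * Real.cos p.2, p.1 * Real.sin p.2) :=
    hm.comp hsm
  rw [lintegral_prod_symm _ (by fun_prop)]
  calc _ ≤ ∫⁻ θ in Set.Ioo (-Real.pi) Real.pi, ENNReal.ofReal (3 / 2 * B ^ 2) := by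
        refine lintegral_mono fun θ => ?_
        have h2 := rpow_lint (B ^ 3) (by positivity)
        have h3 : (B ^ 3) ^ (2 / 3 : ℝ) = B ^ 2 := by
          rw [← Real.rpow_natCast, ← Real.rpow_mul hB.le, ← Real.rpow_natCast]; norm_num
        rw [h3] at h2
        rw [← h2, ← lintegral_indicator measurableSet_Ioi, ← lintegral_indicator measurableSet_Ioc]
        refine lintegral_mono fun r => ?_
        simp only [Set.indicator_apply, Set.mem_Ioi, Set.mem_Ioc, hF, Set.mem_ofPred_eq]
        by_cases h0 : 0 < r
        · simp only [nw_polar r θ h0, h0, if_true, true_and]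
          by_cases h1 : r ^ (1 / 3 : ℝ) < B
          · have h4 : r ≤ B ^ 3 := by
              have : r = (r ^ (1 / 3 : ℝ)) ^ 3 := by
                rw [← Real.rpow_natCast, ← Real.rpow_mul h0.le]; norm_num
              rw [this]
              gcongr
            simp only [h1, h4, if_true]
            rw [← ENNReal.ofReal_mul h0.le]
            refine le_of_eq ?_
            congr 1
            rw [← Real.rpow_natCast, ← Real.rpow_mul h0.le, ← Real.rpow_neg h0.le]
            nth_rewrite 1 [← Real.rpow_one r]
            rw [← Real.rpow_add h0]
            norm_num
          · simp only [h1, if_false, mul_zero, zero_le]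
        · simp [h0]
    _ = _ := by
        rw [lintegral_const]
        simp only [MeasurableSet.univ, Measure.restrict_apply, Set.univ_inter, Real.volume_Ioo]
        rw [← ENNReal.ofReal_mul (by positivity)]
        congr 1
        ring

lemma low_bound (f : ℝ × ℝ → ℂ) (hf : Measurable f) (B : ℝ) (hB : 0 < B) :
    ∫⁻ η : ℝ × ℝ, {η : ℝ × ℝ | nw η < B}.indicator (fun η => ‖f η‖ₑ) η
      ≤ (ENNReal.ofReal (3 * Real.pi * B ^ 2)) ^ (1 / 2 : ℝ) *
        (∫⁻ η, ENNReal.ofReal (nw η ^ 4) * ‖f η‖ₑ ^ 2) ^ (1 / 2 : ℝ) := by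
  classical
  have hn := nw_meas
  have hset : MeasurableSet {η : ℝ × ℝ | nw η < B} := measurableSet_lt hn measurable_const
  set u : ℝ × ℝ → ℝ≥0∞ := {η : ℝ × ℝ | nw η < B}.indicator
    (fun η => ENNReal.ofReal ((nw η ^ 2)⁻¹)) with hu
  set v : ℝ × ℝ → ℝ≥0∞ := fun η => ENNReal.ofReal (nw η ^ 2) * ‖f η‖ₑ with hv
  have hum : Measurable u := Measurable.indicator (by fun_prop) hset
  have hvm : Measurable v := by rw [hv]; fun_prop
  have hCS := ENNReal.lintegral_mul_le_Lp_mul_Lq volume Real.HolderConjugate.two_two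
    hum.aemeasurable hvm.aemeasurable
  have hae : ∀ᵐ η : ℝ × ℝ, η ≠ 0 := by
    simp [ae_iff]
  calc _ ≤ ∫⁻ η, (u * v) η := by
        refine lintegral_mono_ae ?_
        filter_upwards [hae] with η hη
        have hp := nw_pos η hη
        simp only [Pi.mul_apply, hu, hv, Set.indicator_apply]
        split_ifs
        · rw [← mul_assoc, ← ENNReal.ofReal_mul (by positivity), inv_mul_cancel₀ (by positivity)]
          simp
        · simp
    _ ≤ _ := hCS
    _ ≤ _ := by
        gcongr
        · refine le_trans (le_of_eq ?_) (low_int B hB)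
          congr 1
          ext η
          simp only [hu, Set.indicator_apply]
          split_ifs
          · rw [ENNReal.rpow_two, ← ENNReal.ofReal_pow (by positivity)]
            congr 1
            rw [inv_pow, ← pow_mul]
          · simp
        · refine le_of_eq ?_
          simp only [hv]
          rw [ENNReal.rpow_two, mul_pow, ← ENNReal.ofReal_pow (by positivity), ← pow_mul]

lemma sobolev_2d (f : ℝ × ℝ → ℂ) (hf : Measurable f) (hfi : Integrable f) :
    ∫⁻ x : ℝ × ℝ, ‖∫ η : ℝ × ℝ, cexp (I * ↑(x.1 * η.1 + x.2 * η.2)) * f η‖ₑ ^ 6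
      ≤ ENNReal.ofReal (2304 * Real.pi ^ 4) *
        (∫⁻ η, ENNReal.ofReal (nw η ^ 4) * ‖f η‖ₑ ^ 2) ^ 3 := by
  classical
  have hn := nw_meas
  set M := ∫⁻ η, ENNReal.ofReal (nw η ^ 4) * ‖f η‖ₑ ^ 2 with hM
  have hae : ∀ᵐ η : ℝ × ℝ, η ≠ 0 := by
    simp [ae_iff]
  rcases eq_or_ne M ⊤ with hT | hT
  · rw [hT]
    rw [ENNReal.top_pow (by norm_num), ENNReal.mul_top]
    · exact le_top
    · simp only [ne_eq, ENNReal.ofReal_eq_zero, not_le]; positivity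
  rcases eq_or_ne M 0 with h0 | h0
  · have : f =ᵐ[volume] 0 := by
      rw [hM, lintegral_eq_zero_iff (by fun_prop)] at h0
      filter_upwards [h0, hae] with η h1 h2
      have hp := nw_pos η h2
      simp only [Pi.zero_apply, mul_eq_zero, ENNReal.ofReal_eq_zero, not_le] at h1
      rcases h1 with h1 | h1
      · exact absurd h1 (by simpa using by positivity)
      · simpa using h1
    have h2 : ∀ x : ℝ × ℝ, ∫ η : ℝ × ℝ, cexp (I * ↑(x.1 * η.1 + x.2 * η.2)) * f η = 0 := by
      intro x
      rw [integral_eq_zero_of_ae]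
      filter_upwards [this] with η h
      simp [h]
    simp only [h2]
    simp
  set m := M.toReal with hm
  have hmpos : 0 < m := ENNReal.toReal_pos h0 hT
  have hMm : M = ENNReal.ofReal m := (ENNReal.ofReal_toReal hT).symm
  set K := Real.sqrt (12 * Real.pi * m) with hK
  have hKpos : 0 < K := by rw [hK]; positivity
  have hKsq : K ^ 2 = 12 * Real.pi * m := by rw [hK, Real.sq_sqrt (by positivity)]
  set hi : ℝ → ℝ × ℝ → ℂ := fun l η => if l ≤ K * nw η then f η else 0 with hhi
  have hset : MeasurableSet {z : ℝ × (ℝ × ℝ) | z.1 ≤ K * nw z.2} :=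
    measurableSet_le (by fun_prop) (by fun_prop)
  have hsetl : ∀ l : ℝ, MeasurableSet {z : (ℝ × ℝ) | l ≤ K * nw z} := fun l =>
    measurableSet_le (by fun_prop) (by fun_prop)
  have hhim : ∀ l, Measurable (hi l) := fun l => Measurable.ite (hsetl l) hf measurable_const
  have hhii : ∀ l, Integrable (hi l) := by
    intro l
    have := hfi.indicator (hsetl l)
    refine this.congr (Filter.Eventually.of_forall fun η => ?_)
    simp only [Set.indicator_apply, hhi, Set.mem_ofPred_eq]
  have hnorm : ∀ r : ℝ, ‖cexp (I * (r : ℂ))‖ₑ = 1 := fun r => by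
    rw [← ofReal_norm, mul_comm, Complex.norm_exp_ofReal_mul_I r]; simp
  set F : ℝ × ℝ → ℂ := fun x => ∫ η : ℝ × ℝ, cexp (I * ↑(x.1 * η.1 + x.2 * η.2)) * f η with hF
  set Hh : ℝ → ℝ × ℝ → ℂ := fun l x =>
    ∫ η : ℝ × ℝ, cexp (I * ↑(x.1 * η.1 + x.2 * η.2)) * hi l η with hHh
  have hHm : Measurable fun z : ℝ × (ℝ × ℝ) => ‖Hh z.1 z.2‖ₑ := by
    refine (StronglyMeasurable.measurable ?_).enorm
    refine StronglyMeasurable.integral_prod_right'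
      (f := fun q : (ℝ × (ℝ × ℝ)) × (ℝ × ℝ) =>
        cexp (I * ↑(q.1.2.1 * q.2.1 + q.1.2.2 * q.2.2)) * hi q.1.1 q.2)
      (Measurable.stronglyMeasurable ?_)
    have : Measurable fun q : (ℝ × (ℝ × ℝ)) × (ℝ × ℝ) => hi q.1.1 q.2 := by
      simp only [hhi]
      refine Measurable.ite (measurableSet_le (by fun_prop) (by fun_prop)) (by fun_prop)
        measurable_const
    exact Measurable.mul (by fun_prop) this
  have hexpi : ∀ (x : ℝ × ℝ) (g : ℝ × ℝ → ℂ), Integrable g →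
      Integrable (fun η : ℝ × ℝ => cexp (I * ↑(x.1 * η.1 + x.2 * η.2)) * g η) := by
    intro x g hg
    refine hg.bdd_mul (c := 1) ?_ ?_
    · exact Measurable.aestronglyMeasurable (by fun_prop)
    · refine Filter.Eventually.of_forall fun η => ?_
      rw [mul_comm, Complex.norm_exp_ofReal_mul_I]
  -- low frequencies
  have hlow : ∀ l : ℝ, 0 < l → ∀ x, ‖F x‖ₑ ≤ ‖Hh l x‖ₑ + ENNReal.ofReal (l / 2) := by
    intro l hl x
    have hd : F x = Hh l x + ∫ η : ℝ × ℝ, cexp (I * ↑(x.1 * η.1 + x.2 * η.2)) * (f η - hi l η) := by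
      simp only [hF, hHh]
      rw [← integral_add (hexpi x _ (hhii l)) (hexpi x (fun η => f η - hi l η) (hfi.sub (hhii l)))]
      congr 1
      ext η
      ring
    rw [hd]
    refine (enorm_add_le _ _).trans ?_
    gcongr
    refine (enorm_integral_le_lintegral_enorm _).trans ?_
    have hB : 0 < l / K := by positivity
    calc _ = ∫⁻ η : ℝ × ℝ, {η : ℝ × ℝ | nw η < l / K}.indicator (fun η => ‖f η‖ₑ) η := by
          congr 1
          ext η
          rw [enorm_mul, hnorm, one_mul]
          simp only [hhi, Set.indicator_apply, Set.mem_ofPred_eq, lt_div_iff₀ hKpos]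
          by_cases h : l ≤ K * nw η
          · have : ¬ (nw η * K < l) := by rw [mul_comm]; exact not_lt.2 h
            simp [h, this]
          · have : nw η * K < l := by rw [mul_comm]; exact not_le.1 h
            simp [h, this]
      _ ≤ _ := low_bound f hf _ hB
      _ = (ENNReal.ofReal ((l / 2) ^ 2)) ^ (1 / 2 : ℝ) := by
          rw [← hM, hMm, ← ENNReal.mul_rpow_of_nonneg _ _ (by norm_num),
            ← ENNReal.ofReal_mul (by positivity)]
          congr 2
          rw [div_pow, hKsq]
          field_simp
          ring
      _ = _ := by
          rw [ENNReal.ofReal_pow (by positivity), ← ENNReal.rpow_two, ← ENNReal.rpow_mul]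
          norm_num
  have hpt : ∀ x, ‖F x‖ₑ ^ 6 ≤ 16 * ∫⁻ l in Set.Ioi (0 : ℝ), ENNReal.ofReal (l ^ 3) * ‖Hh l x‖ₑ ^ 2 := by
    intro x
    set s := ‖F x‖ with hs
    have hs0 : 0 ≤ s := norm_nonneg _
    have hsF : ‖F x‖ₑ = ENNReal.ofReal s := (ofReal_norm _).symm
    calc ‖F x‖ₑ ^ 6 = 16 * ∫⁻ l in Set.Ioc (0 : ℝ) s, ENNReal.ofReal (l ^ 3) *
            ENNReal.ofReal ((s / 2) ^ 2) := by
          rw [lintegral_mul_const _ (by fun_prop), cube_lint s hs0, hsF,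
            ← ENNReal.ofReal_mul (by positivity), ← ENNReal.ofReal_pow hs0,
            show (16 : ℝ≥0∞) = ENNReal.ofReal 16 by norm_num, ← ENNReal.ofReal_mul (by norm_num)]
          congr 1
          ring
      _ ≤ 16 * ∫⁻ l in Set.Ioc (0 : ℝ) s, ENNReal.ofReal (l ^ 3) * ‖Hh l x‖ₑ ^ 2 := by
          refine mul_le_mul_right (setLIntegral_mono' measurableSet_Ioc fun l hl => ?_) _
          rw [ENNReal.ofReal_pow (by positivity : 0 ≤ s / 2)]
          refine mul_le_mul_right (pow_le_pow_left' ?_ 2) _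
          have := hlow l hl.1 x
          rw [hsF, ← ofReal_norm, ← ENNReal.ofReal_add (by positivity) (by linarith [hl.1]),
            ENNReal.ofReal_le_ofReal_iff (by linarith [hl.1, norm_nonneg (Hh l x)])] at this
          rw [← ofReal_norm]
          exact ENNReal.ofReal_le_ofReal (by linarith [hl.2])
      _ ≤ _ := by
          gcongr
          exact Set.Ioc_subset_Ioi_self
  have hpl : ∀ l, ∫⁻ x, ‖Hh l x‖ₑ ^ 2 ≤ ENNReal.ofReal ((2 * Real.pi) ^ 2) * ∫⁻ η, ‖hi l η‖ₑ ^ 2 := by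
    intro l
    have := schur_gauss (volume : Measure (ℝ × ℝ)) Prod.fst Prod.snd measurable_fst measurable_snd 1
      (fun G hG => by simp) (hi l) (hhim l) (hhii l)
    rw [mul_one] at this
    exact this
  change ∫⁻ x, ‖F x‖ₑ ^ 6 ≤ _
  clear_value F Hh hi
  calc ∫⁻ x, ‖F x‖ₑ ^ 6 ≤ ∫⁻ x, 16 * ∫⁻ l in Set.Ioi (0 : ℝ), ENNReal.ofReal (l ^ 3) * ‖Hh l x‖ₑ ^ 2 :=
        lintegral_mono hpt
    _ = 16 * ∫⁻ l in Set.Ioi (0 : ℝ), ∫⁻ x, ENNReal.ofReal (l ^ 3) * ‖Hh l x‖ₑ ^ 2 := by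
        rw [lintegral_const_mul' _ _ (by simp), lintegral_lintegral_swap]
        refine Measurable.aemeasurable ?_
        have h2 : Measurable fun z : (ℝ × ℝ) × ℝ => ‖Hh z.2 z.1‖ₑ := hHm.comp (measurable_snd.prodMk measurable_fst)
        unfold Function.uncurry
        exact Measurable.mul (by fun_prop) (h2.pow_const 2)
    _ ≤ 16 * ∫⁻ l in Set.Ioi (0 : ℝ), ENNReal.ofReal (l ^ 3) *
          (ENNReal.ofReal ((2 * Real.pi) ^ 2) * ∫⁻ η, ‖hi l η‖ₑ ^ 2) := by
        gcongr with l
        rw [lintegral_const_mul' _ _ (by simp)]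
        gcongr
        exact hpl l
    _ = 16 * (ENNReal.ofReal ((2 * Real.pi) ^ 2) * ∫⁻ l in Set.Ioi (0 : ℝ), ∫⁻ η,
          ENNReal.ofReal (l ^ 3) * ‖hi l η‖ₑ ^ 2) := by
        congr 1
        rw [← lintegral_const_mul' _ _ (by simp)]
        refine lintegral_congr fun l => ?_
        rw [lintegral_const_mul' _ _ (by simp)]
        ring
    _ = 16 * (ENNReal.ofReal ((2 * Real.pi) ^ 2) * ∫⁻ η, ∫⁻ l in Set.Ioi (0 : ℝ),
          ENNReal.ofReal (l ^ 3) * ‖hi l η‖ₑ ^ 2) := by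
        rw [lintegral_lintegral_swap]
        refine Measurable.aemeasurable ?_
        have h2 : Measurable fun z : ℝ × (ℝ × ℝ) => hi z.1 z.2 := by
          simp only [hhi]
          exact Measurable.ite (measurableSet_le (by fun_prop) (by fun_prop)) (by fun_prop)
            measurable_const
        unfold Function.uncurry
        fun_prop
    _ = 16 * (ENNReal.ofReal ((2 * Real.pi) ^ 2) * ∫⁻ η, ENNReal.ofReal (K ^ 4 / 4) *
          (ENNReal.ofReal (nw η ^ 4) * ‖f η‖ₑ ^ 2)) := by
        congr 3
        ext η
        rw [← mul_assoc, ← ENNReal.ofReal_mul (by positivity),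
          show K ^ 4 / 4 * nw η ^ 4 = (K * nw η) ^ 4 / 4 by ring,
          ← cube_lint _ (mul_nonneg hKpos.le (nw_nonneg η)),
          ← lintegral_mul_const _ (by fun_prop),
          ← lintegral_indicator measurableSet_Ioi, ← lintegral_indicator measurableSet_Ioc]
        congr 1
        ext l
        simp only [Set.indicator_apply, Set.mem_Ioi, Set.mem_Ioc, hhi]
        by_cases h1 : 0 < l <;> by_cases h2 : l ≤ K * nw η <;> simp [h1, h2]
    _ = 16 * (ENNReal.ofReal ((2 * Real.pi) ^ 2) * (ENNReal.ofReal (K ^ 4 / 4) * M)) := by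
        rw [lintegral_const_mul' _ _ (by simp)]
    _ = _ := by
        rw [hMm, show (16 : ℝ≥0∞) = ENNReal.ofReal 16 by norm_num,
          ← ENNReal.ofReal_mul (by positivity), ← ENNReal.ofReal_mul (by positivity),
          ← ENNReal.ofReal_mul (by positivity), ← ENNReal.ofReal_pow (by positivity),
          ← ENNReal.ofReal_mul (by positivity)]
        congr 1
        rw [show K ^ 4 = (K ^ 2) ^ 2 by ring, hKsq]
        ring

lemma slice_strichartz (φ D : ℝ → ℝ × ℝ → ℝ) (hφ : Measurable fun z : ℝ × (ℝ × ℝ) => φ z.1 z.2)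
    (E : ℝ × ℝ → Set ℝ) (κ : ℝ) (hκ : 0 < κ) (σ : ℝ) (hσ : σ = 1 ∨ σ = -1)
    (hE : ∀ᵐ η : ℝ × ℝ, (E η).OrdConnected ∧
      (∀ y ∈ E η, HasDerivAt (fun y => φ y η) (D y η) y) ∧
      ∀ y ∈ E η, ∀ y' ∈ E η, y ≤ y' →
        κ / (η.1 ^ 2 + η.2 ^ 2) * (y' - y) ≤ σ * (D y' η - D y η))
    (h : ℝ × (ℝ × ℝ) → ℂ) (hm : Measurable h) (hi : Integrable h)
    (hsupp : ∀ z : ℝ × (ℝ × ℝ), z.1 ∉ E z.2 → h z = 0) :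
    ∫⁻ q : (ℝ × ℝ) × (ℝ × ℝ), ‖∫ z : ℝ × (ℝ × ℝ), cexp (I * ↑((q.1.1 * z.1 + q.1.2 * φ z.1 z.2) +
        (q.2.1 * z.2.1 + q.2.2 * z.2.2))) * h z‖ₑ ^ 6
      ≤ ENNReal.ofReal (2304 * Real.pi ^ 4) * (ENNReal.ofReal ((2 * Real.pi) ^ 3 / κ) *
        (∫⁻ z : ℝ × (ℝ × ℝ), ENNReal.ofReal (z.2.1 ^ 2 + z.2.2 ^ 2) * ‖h z‖ₑ ^ 2) ^ 3) := by
  have hn := nw_meas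
  have hae : ∀ᵐ η : ℝ × ℝ, η ≠ 0 := by
    simp [ae_iff]
  set V : ℝ × ℝ → ℝ × ℝ → ℂ := fun η w =>
    ∫ y, cexp (I * ↑(w.1 * y + w.2 * φ y η)) * h (y, η) with hV
  have hnorm : ∀ r : ℝ, ‖cexp (I * (r : ℂ))‖ = 1 := fun r => by
    rw [mul_comm, Complex.norm_exp_ofReal_mul_I r]
  have hVm : Measurable fun z : (ℝ × ℝ) × (ℝ × ℝ) => V z.1 z.2 := by
    refine StronglyMeasurable.measurable ?_
    refine StronglyMeasurable.integral_prod_right'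
      (f := fun q : ((ℝ × ℝ) × (ℝ × ℝ)) × ℝ =>
        cexp (I * ↑(q.1.2.1 * q.2 + q.1.2.2 * φ q.2 q.1.1)) * h (q.2, q.1.1))
      (Measurable.stronglyMeasurable ?_)
    have h1 : Measurable fun q : ((ℝ × ℝ) × (ℝ × ℝ)) × ℝ => φ q.2 q.1.1 :=
      hφ.comp (measurable_snd.prodMk (measurable_fst.comp measurable_fst))
    fun_prop
  have hbase : ∀ w : ℝ × ℝ, Integrable
      (fun z : ℝ × (ℝ × ℝ) => cexp (I * ↑(w.1 * z.1 + w.2 * φ z.1 z.2)) * h z) := by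
    intro w
    refine hi.bdd_mul (c := 1) ?_ ?_
    · exact Measurable.aestronglyMeasurable (by fun_prop)
    · exact Filter.Eventually.of_forall fun z => (hnorm _).le
  have hVi : ∀ w, Integrable (fun η => V η w) := by
    intro w
    exact (hbase w).integral_prod_right
  have hT : ∀ q : (ℝ × ℝ) × (ℝ × ℝ),
      ∫ z : ℝ × (ℝ × ℝ), cexp (I * ↑((q.1.1 * z.1 + q.1.2 * φ z.1 z.2) +
        (q.2.1 * z.2.1 + q.2.2 * z.2.2))) * h z =
      ∫ η : ℝ × ℝ, cexp (I * ↑(q.2.1 * η.1 + q.2.2 * η.2)) * V η q.1 := by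
    intro q
    rw [Measure.volume_eq_prod, integral_prod_symm]
    · refine integral_congr_ae (Filter.Eventually.of_forall fun η => ?_)
      simp only [hV]
      rw [← integral_const_mul]
      refine integral_congr_ae (Filter.Eventually.of_forall fun y => ?_)
      simp only
      rw [← mul_assoc, ← Complex.exp_add]
      congr 2
      rw [Complex.ofReal_add]
      ring
    · refine Integrable.bdd_mul (c := 1) hi ?_ ?_
      · exact Measurable.aestronglyMeasurable (by fun_prop)
      · exact Filter.Eventually.of_forall fun z => (hnorm _).le
  have hsl : ∀ᵐ η : ℝ × ℝ, Integrable fun y => h (y, η) := hi.prod_left_ae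
  have hVkey : ∀ᵐ η : ℝ × ℝ, ∫⁻ w, ‖V η w‖ₑ ^ 6 ≤
      ENNReal.ofReal ((2 * Real.pi) ^ 3 / (κ / (η.1 ^ 2 + η.2 ^ 2))) * (∫⁻ y, ‖h (y, η)‖ₑ ^ 2) ^ 3 := by
    filter_upwards [hsl, hE, hae] with η h1 h2 h3
    have h4 : 0 < η.1 ^ 2 + η.2 ^ 2 := by rw [← nw_pow6]; have := nw_pos η h3; positivity
    exact strichartz_1d (E η) h2.1 (fun y => φ y η) (fun y => D y η)
      (hφ.comp (measurable_id.prodMk measurable_const)) h2.2.1 _ (by positivity) σ hσ h2.2.2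
      (fun y => h (y, η)) (hm.comp (measurable_id.prodMk measurable_const)) h1
      (fun y hy => hsupp (y, η) hy)
  clear_value V
  simp only [hT]
  have hTm : Measurable fun q : (ℝ × ℝ) × (ℝ × ℝ) =>
      ∫ η : ℝ × ℝ, cexp (I * ↑(q.2.1 * η.1 + q.2.2 * η.2)) * V η q.1 := by
    refine StronglyMeasurable.measurable ?_
    refine StronglyMeasurable.integral_prod_right'
      (f := fun p : ((ℝ × ℝ) × (ℝ × ℝ)) × (ℝ × ℝ) =>
        cexp (I * ↑(p.1.2.1 * p.2.1 + p.1.2.2 * p.2.2)) * V p.2 p.1.1)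
      (Measurable.stronglyMeasurable ?_)
    have h1 : Measurable fun p : ((ℝ × ℝ) × (ℝ × ℝ)) × (ℝ × ℝ) => V p.2 p.1.1 :=
      hVm.comp (measurable_snd.prodMk (measurable_fst.comp measurable_fst))
    exact Measurable.mul (by fun_prop) h1
  have hVm1 : ∀ w, Measurable fun η => V η w := fun w =>
    hVm.comp (measurable_id.prodMk measurable_const)
  set c := ENNReal.ofReal ((2 * Real.pi) ^ 3 / κ) with hc
  have hAkey : ∀ᵐ η : ℝ × ℝ, (∫⁻ w, (ENNReal.ofReal (nw η ^ 4) * ‖V η w‖ₑ ^ 2) ^ 3) ^ (1 / 3 : ℝ) ≤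
      c ^ (1 / 3 : ℝ) * ∫⁻ y, ENNReal.ofReal (η.1 ^ 2 + η.2 ^ 2) * ‖h (y, η)‖ₑ ^ 2 := by
    filter_upwards [hVkey, hae] with η h1 h3
    have h4 : 0 < η.1 ^ 2 + η.2 ^ 2 := by rw [← nw_pow6]; have := nw_pos η h3; positivity
    have hn0 := nw_nonneg η
    rw [lintegral_const_mul' _ _ (by simp)]
    have e1 : ∀ a : ℝ≥0∞, a = (a ^ 3) ^ (1 / 3 : ℝ) := fun a => by
      rw [← ENNReal.rpow_natCast, ← ENNReal.rpow_mul]; norm_num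
    rw [e1 (ENNReal.ofReal (η.1 ^ 2 + η.2 ^ 2) * ∫⁻ y, ‖h (y, η)‖ₑ ^ 2),
      ← ENNReal.mul_rpow_of_nonneg _ _ (by norm_num)]
    refine ENNReal.rpow_le_rpow ?_ (by norm_num)
    simp only [mul_pow, ← pow_mul]
    rw [lintegral_const_mul' _ _ (by simp)]
    calc _ ≤ ENNReal.ofReal (nw η ^ 4) ^ 3 * _ := mul_le_mul_right h1 _
      _ = _ := by
        rw [← mul_assoc, ← mul_assoc, hc, ← ENNReal.ofReal_pow (by positivity),
          ← ENNReal.ofReal_pow (by positivity), ← ENNReal.ofReal_mul (by positivity),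
          ← ENNReal.ofReal_mul (by positivity)]
        congr 2
        rw [← nw_pow6]
        field_simp
  have hAm : Measurable fun z : (ℝ × ℝ) × (ℝ × ℝ) =>
      ENNReal.ofReal (nw z.1 ^ 4) * ‖V z.1 z.2‖ₑ ^ 2 := by fun_prop
  rw [Measure.volume_eq_prod (ℝ × ℝ) (ℝ × ℝ), lintegral_prod _ (hTm.enorm.pow_const 6).aemeasurable]
  calc _ ≤ ∫⁻ w : ℝ × ℝ, ENNReal.ofReal (2304 * Real.pi ^ 4) *
        (∫⁻ η, ENNReal.ofReal (nw η ^ 4) * ‖V η w‖ₑ ^ 2) ^ 3 := by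
        refine lintegral_mono fun w => ?_
        exact sobolev_2d (fun η => V η w) (hVm1 w) (hVi w)
    _ = ENNReal.ofReal (2304 * Real.pi ^ 4) * ∫⁻ w : ℝ × ℝ,
        (∫⁻ η, ENNReal.ofReal (nw η ^ 4) * ‖V η w‖ₑ ^ 2) ^ 3 := by
        rw [lintegral_const_mul' _ _ ENNReal.ofReal_ne_top]
    _ ≤ _ := by
        refine mul_le_mul_right ?_ _
        refine (minkowski3 volume volume
          (fun η w => ENNReal.ofReal (nw η ^ 4) * ‖V η w‖ₑ ^ 2) hAm).trans ?_
        have h5 : ∫⁻ z : ℝ × (ℝ × ℝ), ENNReal.ofReal (z.2.1 ^ 2 + z.2.2 ^ 2) * ‖h z‖ₑ ^ 2 =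
            ∫⁻ η : ℝ × ℝ, ∫⁻ y, ENNReal.ofReal (η.1 ^ 2 + η.2 ^ 2) * ‖h (y, η)‖ₑ ^ 2 := by
          rw [Measure.volume_eq_prod, lintegral_prod_symm _ (by fun_prop)]
        rw [h5]
        calc _ ≤ (∫⁻ η : ℝ × ℝ, c ^ (1 / 3 : ℝ) *
              ∫⁻ y, ENNReal.ofReal (η.1 ^ 2 + η.2 ^ 2) * ‖h (y, η)‖ₑ ^ 2) ^ 3 :=
              pow_le_pow_left' (lintegral_mono_ae hAkey) 3
          _ = _ := by
            rw [lintegral_const_mul' _ _ (by rw [hc]; simp), mul_pow]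
            congr 1
            rw [← ENNReal.rpow_natCast, ← ENNReal.rpow_mul]; norm_num

/-- The set of `y` with `y² ≤ c` is order connected. -/
lemma ordConn_sq (c : ℝ) : {y : ℝ | y ^ 2 ≤ c}.OrdConnected := by
  refine ⟨fun x hx y hy z hz => ?_⟩
  simp only [Set.mem_ofPred_eq] at *
  obtain ⟨h1, h2⟩ := hz
  rcases le_total 0 z with h | h <;> nlinarith

lemma mono_of_deriv (S : Set ℝ) (hS : S.OrdConnected) (D D' : ℝ → ℝ) (c : ℝ)
    (hD : ∀ y, HasDerivAt D (D' y) y) (hc : ∀ y ∈ S, c ≤ D' y) :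
    ∀ y ∈ S, ∀ y' ∈ S, y ≤ y' → c * (y' - y) ≤ D y' - D y := by
  refine hS.convex.mul_sub_le_image_sub_of_le_deriv ?_ ?_ ?_
  · exact fun y _ => (hD y).continuousAt.continuousWithinAt
  · exact fun y _ => (hD y).differentiableAt.differentiableWithinAt
  · exact fun y hy => by rw [(hD y).deriv]; exact hc y (interior_subset hy)

lemma sqrt_deriv (c y : ℝ) (hc : 0 < c) :
    HasDerivAt (fun y => Real.sqrt (y ^ 2 + c)) (y / Real.sqrt (y ^ 2 + c)) y := by
  have h1 : HasDerivAt (fun y : ℝ => y ^ 2 + c) (2 * y) y := by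
    simpa using (hasDerivAt_pow 2 y).add_const c
  have h2 := h1.sqrt (by positivity)
  convert h2 using 1
  have : 0 < Real.sqrt (y ^ 2 + c) := by positivity
  field_simp

/-- Phase on the region where the horizontal frequency dominates. -/
def phA (y : ℝ) (η : ℝ × ℝ) : ℝ :=
  Real.sqrt (η.1 ^ 2 + η.2 ^ 2) / Real.sqrt (y ^ 2 + (η.1 ^ 2 + η.2 ^ 2))

def dA (y : ℝ) (η : ℝ × ℝ) : ℝ :=
  -(Real.sqrt (η.1 ^ 2 + η.2 ^ 2) * y / Real.sqrt (y ^ 2 + (η.1 ^ 2 + η.2 ^ 2)) ^ 3)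

lemma phA_deriv (η : ℝ × ℝ) (hη : 0 < η.1 ^ 2 + η.2 ^ 2) (y : ℝ) :
    HasDerivAt (fun y => phA y η) (dA y η) y := by
  unfold phA dA
  have hρ : 0 < Real.sqrt (y ^ 2 + (η.1 ^ 2 + η.2 ^ 2)) := by positivity
  have h := (hasDerivAt_const y (Real.sqrt (η.1 ^ 2 + η.2 ^ 2))).div (sqrt_deriv _ y hη) hρ.ne'
  refine HasDerivAt.congr_deriv h ?_
  field_simp
  ring

lemma dA_deriv (η : ℝ × ℝ) (hη : 0 < η.1 ^ 2 + η.2 ^ 2) (y : ℝ) :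
    HasDerivAt (fun y => -dA y η) (Real.sqrt (η.1 ^ 2 + η.2 ^ 2) * (η.1 ^ 2 + η.2 ^ 2 - 2 * y ^ 2) /
      Real.sqrt (y ^ 2 + (η.1 ^ 2 + η.2 ^ 2)) ^ 5) y := by
  unfold dA
  simp only [neg_neg]
  set c := η.1 ^ 2 + η.2 ^ 2 with hc
  have hρ : 0 < Real.sqrt (y ^ 2 + c) := by positivity
  have hsq : Real.sqrt (y ^ 2 + c) ^ 2 = y ^ 2 + c := Real.sq_sqrt (by positivity)
  have h := ((hasDerivAt_id y).const_mul (Real.sqrt c)).div ((sqrt_deriv _ y hη).pow 3)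
    (pow_pos hρ 3).ne'
  refine HasDerivAt.congr_deriv h ?_
  simp only [id, Nat.cast_ofNat, Pi.pow_apply]
  rw [show c - 2 * y ^ 2 = Real.sqrt (y ^ 2 + c) ^ 2 - 3 * y ^ 2 by rw [hsq]; ring]
  field_simp
  ring

lemma dA_mono (η : ℝ × ℝ) (hη : 0 < η.1 ^ 2 + η.2 ^ 2) :
    ∀ y ∈ {y : ℝ | y ^ 2 ≤ (η.1 ^ 2 + η.2 ^ 2) / 4},
    ∀ y' ∈ {y : ℝ | y ^ 2 ≤ (η.1 ^ 2 + η.2 ^ 2) / 4}, y ≤ y' →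
      (1 / 120) / (η.1 ^ 2 + η.2 ^ 2) * (y' - y) ≤ -dA y' η - -dA y η := by
  refine mono_of_deriv _ (ordConn_sq _) (fun y => -dA y η) _ _ (dA_deriv η hη) ?_
  intro y hy
  simp only [Set.mem_ofPred_eq] at hy
  set c := η.1 ^ 2 + η.2 ^ 2 with hc
  have hR : 0 < Real.sqrt c := by positivity
  have hR2 : Real.sqrt c ^ 2 = c := Real.sq_sqrt hη.le
  have hρ : 0 < Real.sqrt (y ^ 2 + c) := by positivity
  have hle : Real.sqrt (y ^ 2 + c) ≤ 2 * Real.sqrt c := by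
    rw [show 2 * Real.sqrt c = Real.sqrt (4 * c) by
      rw [Real.sqrt_mul (by norm_num)]
      congr 1
      rw [show (4 : ℝ) = 2 ^ 2 by norm_num, Real.sqrt_sq (by norm_num)]]
    exact Real.sqrt_le_sqrt (by linarith)
  rw [div_le_div_iff₀ hη (by positivity)]
  have h5 : Real.sqrt (y ^ 2 + c) ^ 5 ≤ (2 * Real.sqrt c) ^ 5 := by gcongr
  have h6 : (2 * Real.sqrt c) ^ 5 = 32 * (Real.sqrt c * c * c) := by
    rw [show (2 * Real.sqrt c) ^ 5 = 32 * (Real.sqrt c * Real.sqrt c ^ 2 * Real.sqrt c ^ 2) by ring, hR2]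
  have h7 : Real.sqrt c * c * (c / 2) ≤ Real.sqrt c * c * (c - 2 * y ^ 2) := by
    gcongr; linarith
  have h8 : 0 < Real.sqrt c * c * c := by positivity
  nlinarith

/-- Phase on the regions where the vertical frequency dominates. -/
def phC (y : ℝ) (η : ℝ × ℝ) : ℝ :=
  Real.sqrt (y ^ 2 + η.1 ^ 2) / Real.sqrt (y ^ 2 + (η.1 ^ 2 + η.2 ^ 2))

def dC (y : ℝ) (η : ℝ × ℝ) : ℝ :=
  y * η.2 ^ 2 / (Real.sqrt (y ^ 2 + η.1 ^ 2) * Real.sqrt (y ^ 2 + (η.1 ^ 2 + η.2 ^ 2)) ^ 3)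

lemma phC_deriv (η : ℝ × ℝ) (hη : η.1 ≠ 0) (y : ℝ) :
    HasDerivAt (fun y => phC y η) (dC y η) y := by
  unfold phC dC
  have hr : 0 < Real.sqrt (y ^ 2 + η.1 ^ 2) := by positivity
  have hρ : 0 < Real.sqrt (y ^ 2 + (η.1 ^ 2 + η.2 ^ 2)) := by positivity
  have h := (sqrt_deriv (η.1 ^ 2) y (by positivity)).div
    (sqrt_deriv (η.1 ^ 2 + η.2 ^ 2) y (by positivity)) hρ.ne'
  refine HasDerivAt.congr_deriv h ?_
  have hr2 : Real.sqrt (y ^ 2 + η.1 ^ 2) ^ 2 = y ^ 2 + η.1 ^ 2 := Real.sq_sqrt (by positivity)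
  have hρ2 : Real.sqrt (y ^ 2 + (η.1 ^ 2 + η.2 ^ 2)) ^ 2 = y ^ 2 + (η.1 ^ 2 + η.2 ^ 2) :=
    Real.sq_sqrt (by positivity)
  rw [show η.2 ^ 2 = Real.sqrt (y ^ 2 + (η.1 ^ 2 + η.2 ^ 2)) ^ 2 -
    Real.sqrt (y ^ 2 + η.1 ^ 2) ^ 2 by rw [hr2, hρ2]; ring]
  rw [show y ^ 2 + (η.1 ^ 2 + (Real.sqrt (y ^ 2 + (η.1 ^ 2 + η.2 ^ 2)) ^ 2 -
    Real.sqrt (y ^ 2 + η.1 ^ 2) ^ 2)) = y ^ 2 + (η.1 ^ 2 + η.2 ^ 2) by rw [hr2, hρ2]; ring]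
  field_simp

lemma dC_deriv (η : ℝ × ℝ) (hη : η.1 ≠ 0) (y : ℝ) :
    HasDerivAt (fun y => dC y η) (η.2 ^ 2 * (η.1 ^ 2 * (y ^ 2 + (η.1 ^ 2 + η.2 ^ 2)) -
      3 * y ^ 2 * (y ^ 2 + η.1 ^ 2)) / (Real.sqrt (y ^ 2 + η.1 ^ 2) ^ 3 *
        Real.sqrt (y ^ 2 + (η.1 ^ 2 + η.2 ^ 2)) ^ 5)) y := by
  unfold dC
  set b2 := η.2 ^ 2 with hb2
  have hr : 0 < Real.sqrt (y ^ 2 + η.1 ^ 2) := by positivity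
  have hρ : 0 < Real.sqrt (y ^ 2 + (η.1 ^ 2 + b2)) := by positivity
  have h := ((hasDerivAt_id y).mul_const b2).div ((sqrt_deriv (η.1 ^ 2) y (by positivity)).mul
    ((sqrt_deriv (η.1 ^ 2 + b2) y (by positivity)).pow 3)) (mul_pos hr (pow_pos hρ 3)).ne'
  refine HasDerivAt.congr_deriv h ?_
  have hr2 : Real.sqrt (y ^ 2 + η.1 ^ 2) ^ 2 = y ^ 2 + η.1 ^ 2 := Real.sq_sqrt (by positivity)
  have hρ2 : Real.sqrt (y ^ 2 + (η.1 ^ 2 + b2)) ^ 2 = y ^ 2 + (η.1 ^ 2 + b2) :=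
    Real.sq_sqrt (by positivity)
  simp only [id, Nat.cast_ofNat, Pi.pow_apply, Pi.mul_apply]
  generalize Real.sqrt (y ^ 2 + η.1 ^ 2) = r at *
  generalize Real.sqrt (y ^ 2 + (η.1 ^ 2 + b2)) = ρ at *
  rw [← hρ2, ← hr2, show η.1 ^ 2 = r ^ 2 - y ^ 2 by rw [hr2]; ring]
  field_simp
  ring

lemma dC_mono (η : ℝ × ℝ) (hη : η.1 ≠ 0) (hη2 : η.2 ≠ 0) :
    ∀ y ∈ {y : ℝ | y ^ 2 ≤ min (η.1 ^ 2 / 4) (4 * η.2 ^ 2 - η.1 ^ 2)},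
    ∀ y' ∈ {y : ℝ | y ^ 2 ≤ min (η.1 ^ 2 / 4) (4 * η.2 ^ 2 - η.1 ^ 2)}, y ≤ y' →
      (1 / 120) / (η.1 ^ 2 + η.2 ^ 2) * (y' - y) ≤ dC y' η - dC y η := by
  refine mono_of_deriv _ (ordConn_sq _) (fun y => dC y η) _ _ (dC_deriv η hη) ?_
  intro y hy
  simp only [Set.mem_ofPred_eq, le_min_iff] at hy
  obtain ⟨hy1, hy2⟩ := hy
  have ha : 0 < η.1 ^ 2 := by positivity
  have hb : 0 < η.2 ^ 2 := by positivity
  set a2 := η.1 ^ 2 with ha2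
  set b := |η.2| with hbdef
  have hbp : 0 < b := abs_pos.2 hη2
  rw [show η.2 ^ 2 = b ^ 2 from (sq_abs _).symm] at *
  have hr : 0 < Real.sqrt (y ^ 2 + a2) := by positivity
  have hρ : 0 < Real.sqrt (y ^ 2 + (a2 + b ^ 2)) := by positivity
  have hr2 : Real.sqrt (y ^ 2 + a2) ^ 2 = y ^ 2 + a2 := Real.sq_sqrt (by positivity)
  have hρ2 : Real.sqrt (y ^ 2 + (a2 + b ^ 2)) ^ 2 = y ^ 2 + (a2 + b ^ 2) :=
    Real.sq_sqrt (by positivity)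
  generalize Real.sqrt (y ^ 2 + a2) = r at *
  generalize Real.sqrt (y ^ 2 + (a2 + b ^ 2)) = ρ at *
  have hrb : r ≤ 2 * b := by
    refine le_of_sq_le_sq ?_ (by positivity)
    nlinarith
  have hρb : ρ ≤ 9 / 4 * b := by
    refine le_of_sq_le_sq ?_ (by positivity)
    nlinarith
  calc 1 / 120 / (a2 + b ^ 2) ≤ 1 / 120 / b ^ 2 := by gcongr; linarith
    _ ≤ b ^ 2 / (5 * (r * ρ ^ 3)) := by
      rw [div_le_div_iff₀ (by positivity) (by positivity)]
      have h1 : r * ρ ^ 3 ≤ (2 * b) * (9 / 4 * b) ^ 3 := by gcongr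
      nlinarith [pow_pos hbp 4]
    _ = b ^ 2 * (r ^ 2 * ρ ^ 2 / 5) / (r ^ 3 * ρ ^ 5) := by field_simp
    _ ≤ _ := by
      gcongr
      rw [← hρ2, ← hr2]
      have e1 : r ^ 2 * ρ ^ 2 / 5 ≤ a2 * ρ ^ 2 / 4 := by
        have : r ^ 2 ≤ 5 / 4 * a2 := by rw [hr2]; linarith
        nlinarith [pow_pos hρ 2]
      have e2 : 3 * y ^ 2 * r ^ 2 ≤ 3 / 4 * a2 * ρ ^ 2 := by
        have : r ^ 2 ≤ ρ ^ 2 := by rw [hr2, hρ2]; nlinarith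
        have h3 : 3 * y ^ 2 ≤ 3 / 4 * a2 := by linarith
        calc _ ≤ 3 / 4 * a2 * r ^ 2 := by gcongr
          _ ≤ _ := by gcongr
      linarith

/-- Standard coordinates on three-dimensional Euclidean space. -/
def coordE : EuclideanSpace ℝ (Fin 3) ≃ᵐ ℝ × (ℝ × ℝ) :=
  (MeasurableEquiv.toLp 2 (Fin 3 → ℝ)).symm.trans
    ((MeasurableEquiv.piFinSuccAbove (fun _ => ℝ) 0).trans
      (MeasurableEquiv.prodCongr (MeasurableEquiv.refl ℝ) MeasurableEquiv.finTwoArrow))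

lemma coordE_apply (ξ : EuclideanSpace ℝ (Fin 3)) : coordE ξ = (ξ 0, (ξ 1, ξ 2)) := by
  rfl

lemma coordE_mp : MeasurePreserving coordE := by
  unfold coordE
  refine MeasurePreserving.trans
    (EuclideanSpace.volume_preserving_symm_measurableEquiv_toLp (Fin 3)) ?_
  refine MeasurePreserving.trans (volume_preserving_piFinSuccAbove (fun _ : Fin 3 => ℝ) 0) ?_
  exact (MeasurePreserving.id volume).prod (volume_preserving_finTwoArrow ℝ)

/-- Permutation of the space-time variables. -/
def permE : ℝ × (ℝ × (ℝ × ℝ)) ≃ᵐ (ℝ × ℝ) × (ℝ × ℝ) :=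
  (MeasurableEquiv.prodAssoc (α := ℝ) (β := ℝ) (γ := ℝ × ℝ)).symm.trans
    (MeasurableEquiv.prodCongr MeasurableEquiv.prodComm (MeasurableEquiv.refl (ℝ × ℝ)))

lemma permE_apply (z : ℝ × (ℝ × (ℝ × ℝ))) : permE z = ((z.2.1, z.1), z.2.2) := rfl

lemma permE_mp : MeasurePreserving permE := by
  unfold permE
  refine MeasurePreserving.trans (volume_preserving_prodAssoc.symm _) ?_
  exact (Measure.measurePreserving_swap).prod (MeasurePreserving.id volume)

/-- The Strichartz estimate with phase `P` for data supported in `S`. -/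
def GoodOn (P : EuclideanSpace ℝ (Fin 3) → ℝ) (S : Set (EuclideanSpace ℝ (Fin 3))) (C : ℝ≥0∞) :
    Prop :=
  ∀ h : EuclideanSpace ℝ (Fin 3) → ℂ, Measurable h → Integrable h → (∀ ξ, ξ ∉ S → h ξ = 0) →
    ∫⁻ p : ℝ × EuclideanSpace ℝ (Fin 3),
        ‖∫ ξ, cexp (I * ↑(⟪p.2, ξ⟫ + p.1 * P ξ)) * h ξ‖ₑ ^ 6
      ≤ C * (∫⁻ ξ, ENNReal.ofReal (‖ξ‖ ^ 2) * ‖h ξ‖ₑ ^ 2) ^ 3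

lemma good_union (P : EuclideanSpace ℝ (Fin 3) → ℝ) (hP : Measurable P)
    (S T : Set (EuclideanSpace ℝ (Fin 3))) (hS : MeasurableSet S) (C D : ℝ≥0∞)
    (h1 : GoodOn P S C) (h2 : GoodOn P T D) : GoodOn P (S ∪ T) (32 * (C + D)) := by
  classical
  intro h hm hi hsupp
  set f := S.indicator h with hf
  set g := Sᶜ.indicator h with hg
  have hfm : Measurable f := hm.indicator hS
  have hgm : Measurable g := hm.indicator hS.compl
  have hfi : Integrable f := hi.indicator hS
  have hgi : Integrable g := hi.indicator hS.compl
  have hfg : ∀ ξ, h ξ = f ξ + g ξ := fun ξ => by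
    simp only [hf, hg, Set.indicator_apply, Set.mem_compl_iff]
    by_cases hx : ξ ∈ S <;> simp [hx]
  have hf0 : ∀ ξ, ξ ∉ S → f ξ = 0 := fun ξ hx => by simp [hf, hx]
  have hg0 : ∀ ξ, ξ ∉ T → g ξ = 0 := fun ξ hx => by
    simp only [hg, Set.indicator_apply, Set.mem_compl_iff]
    by_cases hs : ξ ∈ S
    · simp [hs]
    · simp only [hs, not_false_eq_true, if_true]
      exact hsupp ξ (by simp [hs, hx])
  have hfle : ∀ ξ, ‖f ξ‖ₑ ≤ ‖h ξ‖ₑ := fun ξ => by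
    simp only [hf]; exact enorm_indicator_le_enorm_self _ _
  have hgle : ∀ ξ, ‖g ξ‖ₑ ≤ ‖h ξ‖ₑ := fun ξ => by
    simp only [hg]; exact enorm_indicator_le_enorm_self _ _
  clear_value f g
  have hexpi : ∀ (p : ℝ × EuclideanSpace ℝ (Fin 3)) (u : EuclideanSpace ℝ (Fin 3) → ℂ),
      Integrable u → Integrable (fun ξ => cexp (I * ↑(⟪p.2, ξ⟫ + p.1 * P ξ)) * u ξ) := by
    intro p u hu
    refine hu.bdd_mul (c := 1) ?_ ?_
    · exact Measurable.aestronglyMeasurable (by fun_prop)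
    · refine Filter.Eventually.of_forall fun η => ?_
      rw [mul_comm, Complex.norm_exp_ofReal_mul_I]
  have hsplit : ∀ p : ℝ × EuclideanSpace ℝ (Fin 3),
      ‖∫ ξ, cexp (I * ↑(⟪p.2, ξ⟫ + p.1 * P ξ)) * h ξ‖ₑ ^ 6 ≤
      32 * (‖∫ ξ, cexp (I * ↑(⟪p.2, ξ⟫ + p.1 * P ξ)) * f ξ‖ₑ ^ 6 +
        ‖∫ ξ, cexp (I * ↑(⟪p.2, ξ⟫ + p.1 * P ξ)) * g ξ‖ₑ ^ 6) := by
    intro p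
    have e : ∫ ξ, cexp (I * ↑(⟪p.2, ξ⟫ + p.1 * P ξ)) * h ξ =
        (∫ ξ, cexp (I * ↑(⟪p.2, ξ⟫ + p.1 * P ξ)) * f ξ) +
          ∫ ξ, cexp (I * ↑(⟪p.2, ξ⟫ + p.1 * P ξ)) * g ξ := by
      rw [← integral_add (hexpi p f hfi) (hexpi p g hgi)]
      refine integral_congr_ae (Filter.Eventually.of_forall fun ξ => ?_)
      simp only
      rw [hfg ξ, mul_add]
    rw [e]
    refine (pow_le_pow_left' (enorm_add_le _ _) 6).trans ?_
    have := ENNReal.rpow_add_le_mul_rpow_add_rpow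
      ‖∫ ξ, cexp (I * ↑(⟪p.2, ξ⟫ + p.1 * P ξ)) * f ξ‖ₑ
      ‖∫ ξ, cexp (I * ↑(⟪p.2, ξ⟫ + p.1 * P ξ)) * g ξ‖ₑ (p := 6) (by norm_num)
    have e2 : (2 : ℝ≥0∞) ^ ((6 : ℝ) - 1) = 32 := by
      rw [show (6 : ℝ) - 1 = ((5 : ℕ) : ℝ) by norm_num, ENNReal.rpow_natCast]; norm_num
    rw [e2, show (6 : ℝ) = ((6 : ℕ) : ℝ) by norm_num] at this
    simp only [ENNReal.rpow_natCast] at this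
    exact this
  have hTm : Measurable fun p : ℝ × EuclideanSpace ℝ (Fin 3) =>
      ∫ ξ, cexp (I * ↑(⟪p.2, ξ⟫ + p.1 * P ξ)) * f ξ := by
    refine StronglyMeasurable.measurable ?_
    refine StronglyMeasurable.integral_prod_right'
      (f := fun q : (ℝ × EuclideanSpace ℝ (Fin 3)) × EuclideanSpace ℝ (Fin 3) =>
        cexp (I * ↑(⟪q.1.2, q.2⟫ + q.1.1 * P q.2)) * f q.2)
      (Measurable.stronglyMeasurable ?_)
    fun_prop
  refine (lintegral_mono hsplit).trans ?_
  rw [lintegral_const_mul' _ _ (by simp), lintegral_add_left (hTm.enorm.pow_const 6), mul_assoc,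
    add_mul]
  refine mul_le_mul_right (add_le_add ?_ ?_) _
  · refine (h1 f hfm hfi hf0).trans ?_
    refine mul_le_mul_right (pow_le_pow_left' (lintegral_mono fun ξ => ?_) 3) _
    exact mul_le_mul_right (pow_le_pow_left' (hfle ξ) 2) _
  · refine (h2 g hgm hgi hg0).trans ?_
    refine mul_le_mul_right (pow_le_pow_left' (lintegral_mono fun ξ => ?_) 3) _
    exact mul_le_mul_right (pow_le_pow_left' (hgle ξ) 2) _

lemma good_frame (U : EuclideanSpace ℝ (Fin 3) ≃ₗᵢ[ℝ] EuclideanSpace ℝ (Fin 3))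
    (φ D : ℝ → ℝ × ℝ → ℝ) (hφ : Measurable fun z : ℝ × (ℝ × ℝ) => φ z.1 z.2)
    (E : ℝ × ℝ → Set ℝ) (κ : ℝ) (hκ : 0 < κ) (σ : ℝ) (hσ : σ = 1 ∨ σ = -1)
    (hE : ∀ᵐ η : ℝ × ℝ, (E η).OrdConnected ∧
      (∀ y ∈ E η, HasDerivAt (fun y => φ y η) (D y η) y) ∧
      ∀ y ∈ E η, ∀ y' ∈ E η, y ≤ y' →
        κ / (η.1 ^ 2 + η.2 ^ 2) * (y' - y) ≤ σ * (D y' η - D y η))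
    (P : EuclideanSpace ℝ (Fin 3) → ℝ) (hP : ∀ ξ, P ξ = φ (U ξ 0) (U ξ 1, U ξ 2))
    (S : Set (EuclideanSpace ℝ (Fin 3))) (hS : ∀ ξ, ξ ∈ S → U ξ 0 ∈ E (U ξ 1, U ξ 2)) :
    GoodOn P S (ENNReal.ofReal (2304 * Real.pi ^ 4) * ENNReal.ofReal ((2 * Real.pi) ^ 3 / κ)) := by
  intro h hm hi hsupp
  set e : EuclideanSpace ℝ (Fin 3) ≃ᵐ ℝ × (ℝ × ℝ) := U.toMeasurableEquiv.trans coordE with he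
  have hemp : MeasurePreserving e := U.measurePreserving.trans coordE_mp
  have hea : ∀ ξ, e ξ = (U ξ 0, (U ξ 1, U ξ 2)) := fun ξ => rfl
  have hin : ∀ x ξ, ⟪x, ξ⟫ = (e x).1 * (e ξ).1 + ((e x).2.1 * (e ξ).2.1 + (e x).2.2 * (e ξ).2.2) := by
    intro x ξ
    rw [← U.inner_map_map, hea, hea, PiLp.inner_apply, Fin.sum_univ_three]
    simp only [RCLike.inner_apply, conj_trivial]
    ring
  have hnm : ∀ ξ, ‖ξ‖ ^ 2 = (e ξ).1 ^ 2 + ((e ξ).2.1 ^ 2 + (e ξ).2.2 ^ 2) := by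
    intro ξ
    rw [← real_inner_self_eq_norm_sq, hin]; ring
  have hPe : ∀ ξ, P ξ = φ (e ξ).1 (e ξ).2 := hP
  have hSe : ∀ ξ, ξ ∈ S → (e ξ).1 ∈ E (e ξ).2 := hS
  clear_value e
  have hmp2 : MeasurePreserving (fun p : ℝ × EuclideanSpace ℝ (Fin 3) => permE (p.1, e p.2)) :=
    permE_mp.comp ((MeasurePreserving.id volume).prod hemp)
  have hemb : MeasurableEmbedding (fun p : ℝ × EuclideanSpace ℝ (Fin 3) => permE (p.1, e p.2)) :=
    (((MeasurableEquiv.refl ℝ).prodCongr e).trans permE).measurableEmbedding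
  have key := slice_strichartz φ D hφ E κ hκ σ hσ hE (fun z => h (e.symm z))
    (hm.comp e.symm.measurable) ((hemp.symm e).integrable_comp_of_integrable hi) (by
      intro z hz
      refine hsupp _ fun hmem => hz ?_
      simpa using hSe _ hmem)
  rw [← hmp2.lintegral_comp_emb hemb] at key
  rw [← hemp.lintegral_comp_emb e.measurableEmbedding] at key
  refine le_trans (le_of_eq (lintegral_congr fun p => ?_)) (key.trans ?_)
  · rw [← hemp.integral_comp e.measurableEmbedding]
    congr 2
    refine integral_congr_ae (Filter.Eventually.of_forall fun ξ => ?_)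
    simp only [permE_apply, MeasurableEquiv.symm_apply_apply]
    rw [hin, hPe]
    congr 4
    ring
  · rw [← mul_assoc]
    refine mul_le_mul_right (pow_le_pow_left' (lintegral_mono fun ξ => ?_) 3) _
    simp only [MeasurableEquiv.symm_apply_apply]
    gcongr
    rw [hnm]
    nlinarith [sq_nonneg (e ξ).1]

/-- Linear isometry putting the vertical variable first. -/
def frameA : EuclideanSpace ℝ (Fin 3) ≃ₗᵢ[ℝ] EuclideanSpace ℝ (Fin 3) :=
  LinearIsometry.toLinearIsometryEquiv
    { toFun := fun ξ => !₂[ξ 2, ξ 0, ξ 1]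
      map_add' := fun x y => by ext i; fin_cases i <;> simp
      map_smul' := fun c x => by ext i; fin_cases i <;> simp
      norm_map' := fun x => by
        simp only [LinearMap.coe_mk, AddHom.coe_mk]
        rw [EuclideanSpace.norm_eq, EuclideanSpace.norm_eq, Fin.sum_univ_three, Fin.sum_univ_three]
        congr 1
        simp
        ring } rfl

lemma frameA_apply (ξ : EuclideanSpace ℝ (Fin 3)) : frameA ξ = !₂[ξ 2, ξ 0, ξ 1] := rfl

/-- Linear isometry rotating the horizontal variables. -/
def frameC (c s : ℝ) (h : c ^ 2 + s ^ 2 = 1) :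
    EuclideanSpace ℝ (Fin 3) ≃ₗᵢ[ℝ] EuclideanSpace ℝ (Fin 3) :=
  LinearIsometry.toLinearIsometryEquiv
    { toFun := fun ξ => !₂[c * ξ 0 + s * ξ 1, s * ξ 0 - c * ξ 1, ξ 2]
      map_add' := fun x y => by ext i; fin_cases i <;> simp <;> ring
      map_smul' := fun c x => by ext i; fin_cases i <;> simp <;> ring
      norm_map' := fun x => by
        simp only [LinearMap.coe_mk, AddHom.coe_mk]
        rw [EuclideanSpace.norm_eq, EuclideanSpace.norm_eq, Fin.sum_univ_three, Fin.sum_univ_three]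
        congr 1
        simp
        linear_combination (x 0 ^ 2 + x 1 ^ 2) * h } rfl

lemma frameC_apply (c s : ℝ) (h : c ^ 2 + s ^ 2 = 1) (ξ : EuclideanSpace ℝ (Fin 3)) :
    frameC c s h ξ = !₂[c * ξ 0 + s * ξ 1, s * ξ 0 - c * ξ 1, ξ 2] := rfl

lemma norm3 (ξ : EuclideanSpace ℝ (Fin 3)) : ‖ξ‖ = Real.sqrt (ξ 0 ^ 2 + ξ 1 ^ 2 + ξ 2 ^ 2) := by
  rw [EuclideanSpace.norm_eq, Fin.sum_univ_three]
  simp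

/-- The basic constant. -/
def kap (N : ℝ) : ℝ≥0∞ :=
  ENNReal.ofReal (2304 * Real.pi ^ 4) * ENNReal.ofReal ((2 * Real.pi) ^ 3 / (N / 120))

lemma good_A (N : ℝ) (hN : 0 < N) (sgn : ℝ) (hs : sgn = 1 ∨ sgn = -1) :
    GoodOn (fun ξ => sgn * N * pStrat ξ)
      {ξ | ξ 2 ^ 2 ≤ (ξ 0 ^ 2 + ξ 1 ^ 2) / 4} (kap N) := by
  have hss : sgn * sgn = 1 := by rcases hs with h | h <;> rw [h] <;> norm_num
  refine good_frame frameA (fun y η => sgn * N * phA y η) (fun y η => sgn * N * dA y η) ?_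
    (fun η => {y : ℝ | y ^ 2 ≤ (η.1 ^ 2 + η.2 ^ 2) / 4}) (N / 120) (by positivity) (-sgn) ?_ ?_ _ ?_ _ ?_
  · unfold phA; fun_prop
  · rcases hs with h | h <;> rw [h] <;> norm_num
  · have hae : ∀ᵐ η : ℝ × ℝ, η ≠ 0 := by simp [ae_iff]
    filter_upwards [hae] with η hη
    have h4 : 0 < η.1 ^ 2 + η.2 ^ 2 := by
      rcases eq_or_ne η.1 0 with h1 | h1
      · have : η.2 ≠ 0 := fun h2 => hη (Prod.ext h1 h2)
        positivity
      · positivity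
    refine ⟨ordConn_sq _, fun y _ => (phA_deriv η h4 y).const_mul _, fun y hy y' hy' hyy => ?_⟩
    have := mul_le_mul_of_nonneg_left (dA_mono η h4 y hy y' hy' hyy) hN.le
    calc _ = N * (1 / 120 / (η.1 ^ 2 + η.2 ^ 2) * (y' - y)) := by ring
      _ ≤ _ := this
      _ = _ := by linear_combination (N * (dA y' η - dA y η)) * hss
  · intro ξ
    simp only [frameA_apply, pStrat, phA, norm3]
    simp
    left
    ring_nf
  · intro ξ hξ
    simpa [frameA_apply] using hξ

lemma good_C (c s : ℝ) (h : c ^ 2 + s ^ 2 = 1) (N : ℝ) (hN : 0 < N) (sgn : ℝ)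
    (hs : sgn = 1 ∨ sgn = -1) :
    GoodOn (fun ξ => sgn * N * pStrat ξ)
      {ξ | ξ 0 ^ 2 + ξ 1 ^ 2 ≤ 4 * ξ 2 ^ 2 ∧ 4 * (c * ξ 0 + s * ξ 1) ^ 2 ≤ (s * ξ 0 - c * ξ 1) ^ 2}
      (kap N) := by
  have hss : sgn * sgn = 1 := by rcases hs with h | h <;> rw [h] <;> norm_num
  refine good_frame (frameC c s h) (fun y η => sgn * N * phC y η) (fun y η => sgn * N * dC y η) ?_
    (fun η => {y : ℝ | y ^ 2 ≤ min (η.1 ^ 2 / 4) (4 * η.2 ^ 2 - η.1 ^ 2)}) (N / 120)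
    (by positivity) sgn hs ?_ _ ?_ _ ?_
  · unfold phC; fun_prop
  · have h1 : ∀ᵐ η : ℝ × ℝ, η.1 ≠ 0 :=
      Measure.quasiMeasurePreserving_fst.ae (p := fun x : ℝ => x ≠ 0) (by simp [ae_iff])
    have h2 : ∀ᵐ η : ℝ × ℝ, η.2 ≠ 0 :=
      Measure.quasiMeasurePreserving_snd.ae (p := fun x : ℝ => x ≠ 0) (by simp [ae_iff])
    filter_upwards [h1, h2] with η h1 h2
    refine ⟨ordConn_sq _, fun y _ => (phC_deriv η h1 y).const_mul _, fun y hy y' hy' hyy => ?_⟩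
    have := mul_le_mul_of_nonneg_left (dC_mono η h1 h2 y hy y' hy' hyy) hN.le
    calc _ = N * (1 / 120 / (η.1 ^ 2 + η.2 ^ 2) * (y' - y)) := by ring
      _ ≤ _ := this
      _ = _ := by linear_combination (-N * (dC y' η - dC y η)) * hss
  · intro ξ
    simp only [frameC_apply, pStrat, phC, norm3]
    have e : (c * ξ 0 + s * ξ 1) ^ 2 + (s * ξ 0 - c * ξ 1) ^ 2 = ξ 0 ^ 2 + ξ 1 ^ 2 := by
      linear_combination (ξ 0 ^ 2 + ξ 1 ^ 2) * h
    have e2 : (c * ξ 0 + s * ξ 1) ^ 2 + ((s * ξ 0 - c * ξ 1) ^ 2 + ξ 2 ^ 2) =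
      ξ 0 ^ 2 + ξ 1 ^ 2 + ξ 2 ^ 2 := by linear_combination e
    change _ = sgn * N * (Real.sqrt ((c * ξ 0 + s * ξ 1) ^ 2 + (s * ξ 0 - c * ξ 1) ^ 2) /
      Real.sqrt ((c * ξ 0 + s * ξ 1) ^ 2 + ((s * ξ 0 - c * ξ 1) ^ 2 + ξ 2 ^ 2)))
    rw [e, e2]
  · intro ξ hξ
    obtain ⟨h1, h2⟩ := hξ
    change (c * ξ 0 + s * ξ 1) ^ 2 ≤ min ((s * ξ 0 - c * ξ 1) ^ 2 / 4)
      (4 * ξ 2 ^ 2 - (s * ξ 0 - c * ξ 1) ^ 2)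
    have e : (c * ξ 0 + s * ξ 1) ^ 2 + (s * ξ 0 - c * ξ 1) ^ 2 = ξ 0 ^ 2 + ξ 1 ^ 2 := by
      linear_combination (ξ 0 ^ 2 + ξ 1 ^ 2) * h
    rw [le_min_iff]
    constructor <;> linarith

lemma pStrat_meas : Measurable pStrat := by unfold pStrat; fun_prop

lemma good_all (N : ℝ) (hN : 0 < N) (sgn : ℝ) (hs : sgn = 1 ∨ sgn = -1) :
    ∃ S, (∀ ξ, ξ ∈ S) ∧ GoodOn (fun ξ => sgn * N * pStrat ξ) S
      (32 * (kap N + 32 * (kap N + 32 * (kap N + 32 * (kap N + kap N))))) := by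
  have hP : Measurable fun ξ => sgn * N * pStrat ξ := by
    have := pStrat_meas
    fun_prop
  set w := Real.sqrt (1 / 2) with hw
  have hw2 : w ^ 2 = 1 / 2 := Real.sq_sqrt (by norm_num)
  have hmC : ∀ c s : ℝ, MeasurableSet {ξ : EuclideanSpace ℝ (Fin 3) |
      ξ 0 ^ 2 + ξ 1 ^ 2 ≤ 4 * ξ 2 ^ 2 ∧ 4 * (c * ξ 0 + s * ξ 1) ^ 2 ≤ (s * ξ 0 - c * ξ 1) ^ 2} :=
    fun c s => by
      have m1 : MeasurableSet {ξ : EuclideanSpace ℝ (Fin 3) | ξ 0 ^ 2 + ξ 1 ^ 2 ≤ 4 * ξ 2 ^ 2} :=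
        measurableSet_le (by fun_prop) (by fun_prop)
      have m2 : MeasurableSet {ξ : EuclideanSpace ℝ (Fin 3) |
          4 * (c * ξ 0 + s * ξ 1) ^ 2 ≤ (s * ξ 0 - c * ξ 1) ^ 2} :=
        measurableSet_le (by fun_prop) (by fun_prop)
      exact m1.inter m2
  have hmA : MeasurableSet {ξ : EuclideanSpace ℝ (Fin 3) | ξ 2 ^ 2 ≤ (ξ 0 ^ 2 + ξ 1 ^ 2) / 4} :=
    measurableSet_le (by fun_prop) (by fun_prop)
  refine ⟨_, ?_, good_union _ hP _ _ hmA _ _ (good_A N hN sgn hs)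
    (good_union _ hP _ _ (hmC 1 0) _ _ (good_C 1 0 (by norm_num) N hN sgn hs)
    (good_union _ hP _ _ (hmC 0 1) _ _ (good_C 0 1 (by norm_num) N hN sgn hs)
    (good_union _ hP _ _ (hmC w w) _ _ (good_C w w (by rw [hw2]; norm_num) N hN sgn hs)
      (good_C w (-w) (by rw [neg_sq, hw2]; norm_num) N hN sgn hs))))⟩
  intro ξ
  simp only [Set.mem_union, Set.mem_ofPred_eq]
  by_cases h0 : ξ 2 ^ 2 ≤ (ξ 0 ^ 2 + ξ 1 ^ 2) / 4
  · exact Or.inl h0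
  refine Or.inr ?_
  have h0' : ξ 0 ^ 2 + ξ 1 ^ 2 ≤ 4 * ξ 2 ^ 2 := by linarith [not_le.1 h0]
  simp only [h0', true_and]
  generalize ξ 0 = a
  generalize ξ 1 = b
  have e1 : (w * a + w * b) ^ 2 = (a + b) ^ 2 / 2 := by linear_combination (a + b) ^ 2 * hw2
  have e2 : (w * a - w * b) ^ 2 = (a - b) ^ 2 / 2 := by linear_combination (a - b) ^ 2 * hw2
  have e3 : (w * a + -w * b) ^ 2 = (a - b) ^ 2 / 2 := by linear_combination (a - b) ^ 2 * hw2
  have e4 : (-w * a - w * b) ^ 2 = (a + b) ^ 2 / 2 := by linear_combination (a + b) ^ 2 * hw2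
  rw [e1, e2, e3, e4]
  by_contra hcon
  simp only [not_or, not_le] at hcon
  obtain ⟨h1, h2, h3, h4⟩ := hcon
  have h1' : 0 < 4 * a ^ 2 - b ^ 2 := by linarith
  have h2' : 0 < 4 * b ^ 2 - a ^ 2 := by linarith
  have h3' : 0 < 3 * a ^ 2 + 3 * b ^ 2 + 10 * (a * b) := by linarith
  have h4' : 0 < 3 * a ^ 2 + 3 * b ^ 2 - 10 * (a * b) := by linarith
  nlinarith [mul_pos h1' h2', mul_pos h3' h4']

open scoped FourierTransform in
lemma fourierTf_eq (g : SchwartzMap (EuclideanSpace ℝ (Fin 3)) ℂ) (ξ : EuclideanSpace ℝ (Fin 3)) :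
    fourierTf (fun x => g x) ξ = (𝓕 g : SchwartzMap (EuclideanSpace ℝ (Fin 3)) ℂ)
      ((2 * Real.pi)⁻¹ • ξ) := by
  rw [SchwartzMap.fourier_coe, Real.fourier_eq']
  unfold fourierTf
  refine integral_congr_ae (Filter.Eventually.of_forall fun x => ?_)
  simp only [smul_eq_mul]
  congr 2
  rw [inner_smul_right, show -2 * Real.pi * ((2 * Real.pi)⁻¹ * ⟪x, ξ⟫) = -⟪x, ξ⟫ by
    have := Real.pi_pos
    field_simp]
  rw [Complex.ofReal_neg]
  ring

lemma fourierTf_facts (g : SchwartzMap (EuclideanSpace ℝ (Fin 3)) ℂ) :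
    Measurable (fourierTf (fun x => g x)) ∧ Integrable (fourierTf (fun x => g x)) ∧
      Integrable (fun ξ => ‖ξ‖ ^ 2 * ‖fourierTf (fun x => g x) ξ‖ ^ 2) := by
  obtain ⟨G, hG⟩ : ∃ G : SchwartzMap (EuclideanSpace ℝ (Fin 3)) ℂ,
      fourierTf (fun x => g x) = fun ξ => G ((2 * Real.pi)⁻¹ • ξ) :=
    ⟨_, funext fun ξ => fourierTf_eq g ξ⟩
  have hpi := Real.pi_pos
  have hc : (2 * Real.pi)⁻¹ ≠ 0 := by positivity
  have hGc : Continuous G := G.continuous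
  rw [hG]
  refine ⟨by fun_prop, G.integrable.comp_smul hc, ?_⟩
  have h1 : Integrable fun ξ => ‖G ξ‖ * (‖ξ‖ ^ 2 * ‖G ξ‖) := by
    refine (G.integrable_pow_mul volume 2).bdd_mul (c := SchwartzMap.seminorm ℝ 0 0 G)
      hGc.norm.aestronglyMeasurable (Filter.Eventually.of_forall fun ξ => ?_)
    rw [norm_norm]
    exact SchwartzMap.norm_le_seminorm ℝ G ξ
  refine ((h1.comp_smul hc).const_mul ((2 * Real.pi) ^ 2)).congr
    (Filter.Eventually.of_forall fun ξ => ?_)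
  simp only [norm_smul, Real.norm_eq_abs, abs_inv, mul_pow]
  rw [abs_of_pos (by positivity)]
  field_simp

theorem strichartz_boussinesq_homogeneous :
    ∃ C : ℝ, 0 < C ∧ ∀ N : ℝ, 0 < N → ∀ sgn : ℝ, (sgn = 1 ∨ sgn = -1) →
      ∀ g : SchwartzMap (EuclideanSpace ℝ (Fin 3)) ℂ,
        eLpNorm (fun p : ℝ × EuclideanSpace ℝ (Fin 3) =>
            ∫ ξ : EuclideanSpace ℝ (Fin 3),
              Complex.exp (Complex.I *
                Complex.ofReal (⟪p.2, ξ⟫ + sgn * p.1 * N * pStrat ξ)) *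
                fourierTf (fun x => g x) ξ) 6 volume
          ≤ ENNReal.ofReal (C * N ^ (-(1 / 6) : ℝ) * sobolevNorm 1 (fun x => g x)) := by
  have hpi := Real.pi_pos
  set B : ℝ := 2130976 * (2304 * Real.pi ^ 4 * ((2 * Real.pi) ^ 3 * 120)) with hB
  have hBpos : 0 < B := by rw [hB]; positivity
  refine ⟨B ^ (1 / 6 : ℝ), by positivity, fun N hN sgn hs g => ?_⟩
  obtain ⟨S, hS, hgood⟩ := good_all N hN sgn hs
  obtain ⟨hm, hi, hw⟩ := fourierTf_facts g
  have key := hgood _ hm hi (fun ξ h => absurd (hS ξ) h)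
  set J := ∫ ξ, ‖ξ‖ ^ 2 * ‖fourierTf (fun x => g x) ξ‖ ^ 2 with hJ
  have hJ0 : 0 ≤ J := integral_nonneg fun ξ => by positivity
  have hJl : ∫⁻ ξ, ENNReal.ofReal (‖ξ‖ ^ 2) * ‖fourierTf (fun x => g x) ξ‖ₑ ^ 2 =
      ENNReal.ofReal J := by
    rw [hJ, ofReal_integral_eq_lintegral_ofReal hw
      (Filter.Eventually.of_forall fun ξ => by positivity)]
    refine lintegral_congr fun ξ => ?_
    rw [ENNReal.ofReal_mul (by positivity), ENNReal.ofReal_pow (norm_nonneg (fourierTf _ ξ)),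
      ofReal_norm]
  have hsob : sobolevNorm 1 (fun x => g x) = J ^ (1 / 2 : ℝ) := by
    unfold sobolevNorm
    rw [hJ]
    congr 2
    ext ξ
    rw [mul_one, Real.rpow_two]
  have hK : 32 * (kap N + 32 * (kap N + 32 * (kap N + 32 * (kap N + kap N)))) =
      ENNReal.ofReal (B / N) := by
    have e : 32 * (kap N + 32 * (kap N + 32 * (kap N + 32 * (kap N + kap N)))) =
        2130976 * kap N := by ring
    rw [e, kap, ← ENNReal.ofReal_mul (by positivity),
      show (2130976 : ℝ≥0∞) = ENNReal.ofReal 2130976 by norm_num,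
      ← ENNReal.ofReal_mul (by norm_num)]
    congr 1
    rw [hB]
    field_simp
  rw [hJl, hK] at key
  rw [eLpNorm_eq_lintegral_rpow_enorm_toReal (by norm_num) (by norm_num)]
  have e6 : (6 : ℝ≥0∞).toReal = 6 := by norm_num
  rw [e6]
  have hfin : (∫⁻ p : ℝ × EuclideanSpace ℝ (Fin 3),
      ‖∫ ξ : EuclideanSpace ℝ (Fin 3), Complex.exp (Complex.I *
        Complex.ofReal (⟪p.2, ξ⟫ + sgn * p.1 * N * pStrat ξ)) *
          fourierTf (fun x => g x) ξ‖ₑ ^ (6 : ℝ)) ≤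
      ENNReal.ofReal (B / N) * ENNReal.ofReal J ^ 3 := by
    refine le_trans (le_of_eq (lintegral_congr fun p => ?_)) key
    rw [show (6 : ℝ) = ((6 : ℕ) : ℝ) by norm_num, ENNReal.rpow_natCast]
    congr 2
    refine integral_congr_ae (Filter.Eventually.of_forall fun ξ => ?_)
    simp only
    congr 4
    ring
  refine (ENNReal.rpow_le_rpow hfin (by norm_num)).trans (le_of_eq ?_)
  rw [← ENNReal.ofReal_pow hJ0, ← ENNReal.ofReal_mul (by positivity),
    ENNReal.ofReal_rpow_of_nonneg (by positivity) (by norm_num), hsob]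
  congr 1
  rw [Real.mul_rpow (by positivity) (by positivity), Real.div_rpow hBpos.le hN.le,
    Real.rpow_neg hN.le, ← Real.rpow_natCast, ← Real.rpow_mul hJ0]
  norm_num [div_eq_mul_inv]

end
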